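/- arXiv:2502.19499 — 2 statements merged into one kernel-verified Lean document; each statement's English description precedes it below -/
import Mathlib

section
/- Let ε ∈ (0, 0.015) and let κ > 0 satisfy F(κ) ≤ ε; set δ_t = κ√t and define ŝ⃗_{t,δ_t}: ℝ^d → ℝ^d by ŝ⃗_{t,δ_t}(x) = (ŝ_{t,δ_t}(x₁), −x₂/t, …, −x_d/t). Then there exists t₁ > 0 (depending on κ, n, D, ε) such that for all t ∈ (0, t₁): (i) δ_t ∈ (0, Δ) and L^{(d)}_t[ŝ⃗_{t,δ_t}] < ε; and (ii) for every f⃗: ℝ^d → ℝ^d whose line restrictions x ↦ f⃗(wx + b) (w a unit vector, b ∈ ℝ^d) are all continuous and differentiable except at finitely many points, if L^{(d)}_t[f⃗] < ε then 2(n − 1)Δ/(t(Δ − δ_t)) < (1 + 8√ε) · R^{(d)}[f⃗], where 2(n − 1)Δ/(t(Δ − δ_t)) equals R^{(d)}[ŝ⃗_{t,δ_t}]. -/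
open MeasureTheory Real Set Filter
open scoped ENNReal

/-- Centered Gaussian density with standard deviation `σ`. -/
noncomputable def gaussD (x σ : ℝ) : ℝ :=
  (Real.sqrt (2 * Real.pi) * σ)⁻¹ * Real.exp (-x ^ 2 / (2 * σ ^ 2))

/-- Training points `y_k = 2(k-1)Δ - D`, `Δ = D/(n-1)`. -/
noncomputable def trainPt (n : ℕ) (D : ℝ) (k : ℕ) : ℝ :=
  2 * ((k : ℝ) - 1) * (D / ((n : ℝ) - 1)) - D

/-- Noised empirical density `p_t`. -/
noncomputable def pEmp (n : ℕ) (D t x : ℝ) : ℝ :=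
  (1 / (n : ℝ)) * ∑ k ∈ Finset.Icc 1 n, gaussD (x - trainPt n D k) (Real.sqrt t)

/-- Empirical score function `(d/dx) log p_t`. -/
noncomputable def scoreEmp (n : ℕ) (D t x : ℝ) : ℝ :=
  deriv (fun y => Real.log (pEmp n D t y)) x

/-- Score matching loss `L_t[f]`. -/
noncomputable def scoreLoss (n : ℕ) (D t : ℝ) (f : ℝ → ℝ) : ℝ :=
  t * ∫ x, |f x - scoreEmp n D t x| ^ 2 * pEmp n D t x

/-- `F(κ) = 2 ∫_κ^∞ (u-κ)² p_N(u;1) du`. -/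
noncomputable def Fgauss (κ : ℝ) : ℝ :=
  2 * ∫ u in Set.Ioi κ, (u - κ) ^ 2 * gaussD u 1

/-- The smoothed piecewise-linear empirical score function `ŝ_{t,δ}` (as a predicate
characterizing it by its defining piecewise formulas). -/
def IsShat (n : ℕ) (D t δ : ℝ) (s : ℝ → ℝ) : Prop :=
  (∀ x ≤ trainPt n D 1 + δ, s x = (trainPt n D 1 - x) / t) ∧
  (∀ x, trainPt n D n - δ ≤ x → s x = (trainPt n D n - x) / t) ∧
  (∀ k, 2 ≤ k → k ≤ n - 1 →
    ∀ x ∈ Set.Icc (trainPt n D k - δ) (trainPt n D k + δ),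
      s x = (trainPt n D k - x) / t) ∧
  (∀ k, 1 ≤ k → k ≤ n - 1 →
    ∀ x ∈ Set.Icc (trainPt n D k + δ) (trainPt n D (k + 1) - δ),
      s x = (δ / (D / ((n : ℝ) - 1) - δ)) * (x - (trainPt n D k + D / ((n : ℝ) - 1))) / t)

/-- Non-smoothness measure `R[f]`: the total variation over ℝ of the derivative `f'`
(taken over the set where `f` is differentiable). -/
noncomputable def Rns (f : ℝ → ℝ) : ℝ≥0∞ :=
  eVariationOn (deriv f) {x | DifferentiableAt ℝ f x}

/-- The `(d+1)`-dimensional noised empirical density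
`p^{(d)}_t(x) = p_t(x₁) ∏_{i≥2} p_N(x_i; √t)`. -/
noncomputable def pEmpD (n : ℕ) (D : ℝ) (d : ℕ) (t : ℝ)
    (x : EuclideanSpace ℝ (Fin (d + 1))) : ℝ :=
  pEmp n D t (x 0) *
    ∏ i ∈ Finset.univ.erase (0 : Fin (d + 1)), gaussD (x i) (Real.sqrt t)

/-- The `(d+1)`-dimensional score matching loss
`L^{(d)}_t[f] = t ∫ ‖f(x) - ∇ log p^{(d)}_t(x)‖² p^{(d)}_t(x) dx`. -/
noncomputable def scoreLossD (n : ℕ) (D : ℝ) (d : ℕ) (t : ℝ)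
    (f : EuclideanSpace ℝ (Fin (d + 1)) → EuclideanSpace ℝ (Fin (d + 1))) : ℝ :=
  t * ∫ x, ‖f x - gradient (fun y => Real.log (pEmpD n D d t y)) x‖ ^ 2 * pEmpD n D d t x

/-- The `(d+1)`-dimensional non-smoothness measure `R^{(d)}[f]`: the supremum over unit
vectors `w` and offsets `b` of the total variation over ℝ of the derivative of the line
restriction `x ↦ f(wx + b)`. -/
noncomputable def RnsD (d : ℕ)
    (f : EuclideanSpace ℝ (Fin (d + 1)) → EuclideanSpace ℝ (Fin (d + 1))) : ℝ≥0∞ :=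
  ⨆ (w : EuclideanSpace ℝ (Fin (d + 1))) (_ : ‖w‖ = 1)
    (b : EuclideanSpace ℝ (Fin (d + 1))),
    eVariationOn (deriv fun x : ℝ => f (x • w + b))
      {x | DifferentiableAt ℝ (fun x : ℝ => f (x • w + b)) x}

/-- Mean value inequality for functions differentiable off a finite set. -/
theorem exists_slope_le_deriv {f : ℝ → ℝ} (hf : Continuous f) {S : Set ℝ} (hS : S.Finite)
    (hd : ∀ x ∉ S, DifferentiableAt ℝ f x) {a b : ℝ} (hab : a < b) :
    ∃ c ∈ Ioo a b, c ∉ S ∧ f b - f a ≤ deriv f c * (b - a) := by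
  obtain ⟨m, hm⟩ : ∃ m, (S ∩ Ioo a b).ncard = m := ⟨_, rfl⟩
  induction m using Nat.strong_induction_on generalizing a b with
  | _ m ih =>
    have hfin : ∀ a b, (S ∩ Ioo a b).Finite := fun a b => hS.subset inter_subset_left
    rcases (S ∩ Ioo a b).eq_empty_or_nonempty with h0 | ⟨s, hsS, hs⟩
    · have hnot : ∀ x ∈ Ioo a b, x ∉ S := fun x hx hxS => by
        have : x ∈ S ∩ Ioo a b := ⟨hxS, hx⟩
        simp [h0] at this
      obtain ⟨c, hc, h⟩ := exists_deriv_eq_slope f hab hf.continuousOn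
        (fun x hx => (hd x (hnot x hx)).differentiableWithinAt)
      refine ⟨c, hc, hnot c hc, ?_⟩
      rw [h, div_mul_cancel₀ _ (sub_pos.2 hab).ne']
    · have h1 : (S ∩ Ioo a s).ncard < m := by
        rw [← hm]
        refine Set.ncard_lt_ncard ⟨?_, fun h => ?_⟩ (hfin a b)
        · exact inter_subset_inter_right _ (Ioo_subset_Ioo_right hs.2.le)
        · exact lt_irrefl s (h ⟨hsS, hs⟩).2.2
      have h2 : (S ∩ Ioo s b).ncard < m := by
        rw [← hm]
        refine Set.ncard_lt_ncard ⟨?_, fun h => ?_⟩ (hfin a b)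
        · exact inter_subset_inter_right _ (Ioo_subset_Ioo_left hs.1.le)
        · exact lt_irrefl s (h ⟨hsS, hs⟩).2.1
      obtain ⟨c₁, hc₁, hc₁S, hc₁'⟩ := ih _ h1 hs.1 rfl
      obtain ⟨c₂, hc₂, hc₂S, hc₂'⟩ := ih _ h2 hs.2 rfl
      have hs1 := hs.1
      have hs2 := hs.2
      rcases le_total (deriv f c₁) (deriv f c₂) with h | h
      · exact ⟨c₂, ⟨hs1.trans hc₂.1, hc₂.2⟩, hc₂S, by nlinarith⟩
      · exact ⟨c₁, ⟨hc₁.1, hc₁.2.trans hs2⟩, hc₁S, by nlinarith⟩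

theorem exists_deriv_le_slope {f : ℝ → ℝ} (hf : Continuous f) {S : Set ℝ} (hS : S.Finite)
    (hd : ∀ x ∉ S, DifferentiableAt ℝ f x) {a b : ℝ} (hab : a < b) :
    ∃ c ∈ Ioo a b, c ∉ S ∧ deriv f c * (b - a) ≤ f b - f a := by
  obtain ⟨c, hc, hcS, h⟩ := exists_slope_le_deriv hf.neg hS (fun x hx => (hd x hx).neg) hab
  refine ⟨c, hc, hcS, ?_⟩
  have h' : deriv (-f) c = -deriv f c := deriv.neg
  rw [h'] at h
  simp only [Pi.neg_apply] at h
  linarith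

/-- The variation of a function dominates the sum of the oscillations along an alternating
sequence of points. -/
theorem ofReal_zigzag_le_eVariationOn {g : ℝ → ℝ} {s : Set ℝ} (N : ℕ) (p q : ℕ → ℝ)
    (hp : ∀ k ≤ N, p k ∈ s) (hq : ∀ k < N, q k ∈ s) (hpq : ∀ k < N, p k ≤ q k)
    (hqp : ∀ k < N, q k ≤ p (k + 1)) :
    ENNReal.ofReal (∑ k ∈ Finset.range N, ((g (q k) - g (p k)) + (g (q k) - g (p (k + 1)))))
      ≤ eVariationOn g s := by
  let u : ℕ → ℝ := fun i => if Even i then p (i / 2) else q (i / 2)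
  have hu0 : ∀ k, u (2 * k) = p k := fun k => by simp [u]
  have hu1 : ∀ k, u (2 * k + 1) = q k := fun k => by
    have : (2 * k + 1) / 2 = k := by omega
    simp [u, this]
  have hstep : ∀ i < 2 * N, u i ≤ u (i + 1) := by
    intro i hi
    rcases Nat.even_or_odd' i with ⟨k, rfl | rfl⟩
    · rw [hu0, hu1]; exact hpq k (by omega)
    · rw [hu1, show 2 * k + 1 + 1 = 2 * (k + 1) by ring, hu0]; exact hqp k (by omega)
  have hmono : MonotoneOn u (Iic (2 * N)) := by
    intro i _ j hj hij
    induction j, hij using Nat.le_induction with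
    | base => exact le_rfl
    | succ j hij ih =>
      have hj' : j + 1 ≤ 2 * N := hj
      exact (ih (show j ≤ 2 * N by omega)).trans (hstep j (by omega))
  have hmem : ∀ i ≤ 2 * N, u i ∈ s := by
    intro i hi
    rcases Nat.even_or_odd' i with ⟨k, rfl | rfl⟩
    · rw [hu0]; exact hp k (by omega)
    · rw [hu1]; exact hq k (by omega)
  refine le_trans ?_ (eVariationOn.sum_le_of_monotoneOn_Iic (f := g) hmono hmem)
  have hsum : ∀ M, ∑ i ∈ Finset.range (2 * M), edist (g (u (i + 1))) (g (u i)) =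
      ∑ k ∈ Finset.range M, (edist (g (q k)) (g (p k)) + edist (g (p (k + 1))) (g (q k))) := by
    intro M
    induction M with
    | zero => simp
    | succ M ih =>
      rw [show 2 * (M + 1) = 2 * M + 1 + 1 by ring, Finset.sum_range_succ, Finset.sum_range_succ,
        ih, Finset.sum_range_succ, hu0, hu1, show 2 * M + 1 + 1 = 2 * (M + 1) by ring, hu0,
        add_assoc]
  rw [hsum]
  have hle : ∀ a b : ℝ, ENNReal.ofReal (a - b) ≤ edist a b := fun a b => by
    rw [edist_dist]; exact ENNReal.ofReal_le_ofReal (le_abs_self _)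
  calc _ ≤ ENNReal.ofReal (∑ k ∈ Finset.range N,
        (|g (q k) - g (p k)| + |g (p (k + 1)) - g (q k)|)) := by
        refine ENNReal.ofReal_le_ofReal (Finset.sum_le_sum fun k _ => ?_)
        rw [abs_sub_comm (g (p (k + 1)))]
        exact add_le_add (le_abs_self _) (le_abs_self _)
    _ = _ := by
        rw [ENNReal.ofReal_sum_of_nonneg (fun _ _ => by positivity)]
        refine Finset.sum_congr rfl fun k _ => ?_
        rw [ENNReal.ofReal_add (abs_nonneg _) (abs_nonneg _), edist_dist, edist_dist,
          Real.dist_eq, Real.dist_eq]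

/-- A function whose increments are dominated by those of a function with bounded total
increase has bounded variation. -/
theorem eVariationOn_le_of_dominated {E : Type*} [PseudoEMetricSpace E] {g : ℝ → E} {s : Set ℝ}
    {T : ℝ → ℝ} {B : ℝ} (hT : Monotone T)
    (hg : ∀ x ∈ s, ∀ y ∈ s, x ≤ y → edist (g y) (g x) ≤ ENNReal.ofReal (T y - T x))
    (hB : ∀ x y, x ≤ y → T y - T x ≤ B) : eVariationOn g s ≤ ENNReal.ofReal B := by
  refine iSup_le fun ⟨m, u, hu, hus⟩ => ?_
  calc ∑ i ∈ Finset.range m, edist (g (u (i + 1))) (g (u i))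
      ≤ ∑ i ∈ Finset.range m, ENNReal.ofReal (T (u (i + 1)) - T (u i)) :=
        Finset.sum_le_sum fun i _ => hg _ (hus i) _ (hus (i + 1)) (hu (Nat.le_succ i))
    _ = ENNReal.ofReal (∑ i ∈ Finset.range m, (T (u (i + 1)) - T (u i))) :=
        (ENNReal.ofReal_sum_of_nonneg fun i _ => sub_nonneg.2 (hT (hu (Nat.le_succ i)))).symm
    _ ≤ ENNReal.ofReal B := by
        rw [Finset.sum_range_sub (fun i => T (u i))]
        exact ENNReal.ofReal_le_ofReal (hB _ _ (hu (Nat.zero_le m)))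

theorem gaussD_pos (x : ℝ) {σ : ℝ} (hσ : 0 < σ) : 0 < gaussD x σ := by
  unfold gaussD; positivity

@[fun_prop]
theorem continuous_gaussD (σ : ℝ) : Continuous fun x => gaussD x σ := by
  unfold gaussD; fun_prop

theorem gaussD_neg (x σ : ℝ) : gaussD (-x) σ = gaussD x σ := by
  simp [gaussD]

theorem gaussD_sqrt_mul {t : ℝ} (ht : 0 < t) (u : ℝ) :
    gaussD (√t * u) (√t) = gaussD u 1 / √t := by
  have h : 0 < √t := Real.sqrt_pos.2 ht
  unfold gaussD
  have : -(√t * u) ^ 2 / (2 * √t ^ 2) = -u ^ 2 / (2 * 1 ^ 2) := by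
    field_simp
  rw [this]
  field_simp

theorem gaussD_sqrt_eq_gaussianPDFReal {t : ℝ} (ht : 0 < t) (x : ℝ) :
    gaussD x (√t) = ProbabilityTheory.gaussianPDFReal 0 ⟨t, ht.le⟩ x := by
  unfold gaussD ProbabilityTheory.gaussianPDFReal
  change _ = (√(2 * π * t))⁻¹ * rexp (-(x - 0) ^ 2 / (2 * t))
  rw [Real.sq_sqrt ht.le, Real.sqrt_mul (by positivity : (0 : ℝ) ≤ 2 * π) t, sub_zero]

theorem integrable_gaussD_sqrt {t : ℝ} (ht : 0 < t) : Integrable fun x => gaussD x (√t) := by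
  simp_rw [gaussD_sqrt_eq_gaussianPDFReal ht]
  exact ProbabilityTheory.integrable_gaussianPDFReal _ _

theorem integral_gaussD_sqrt {t : ℝ} (ht : 0 < t) : ∫ x, gaussD x (√t) = 1 := by
  simp_rw [gaussD_sqrt_eq_gaussianPDFReal ht]
  exact ProbabilityTheory.integral_gaussianPDFReal_eq_one _ (fun h => ht.ne' (congrArg Subtype.val h))

theorem integrable_gaussD_one : Integrable fun x => gaussD x 1 := by
  simpa using integrable_gaussD_sqrt one_pos

theorem integral_gaussD_one : ∫ x, gaussD x 1 = 1 := by
  simpa using integral_gaussD_sqrt one_pos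

theorem integrable_sq_mul_gaussD : Integrable fun u : ℝ => u ^ 2 * gaussD u 1 := by
  have h := integrable_rpow_mul_exp_neg_mul_sq (b := 1 / 2) (by norm_num) (s := 2) (by norm_num)
  refine (h.const_mul (√(2 * π) * 1)⁻¹).congr (ae_of_all _ fun u => ?_)
  simp only [gaussD, Real.rpow_two]
  rw [show -u ^ 2 / (2 * 1 ^ 2) = -(1 / 2) * u ^ 2 by ring]
  ring

theorem integral_sq_mul_gaussD : ∫ u : ℝ, u ^ 2 * gaussD u 1 = 1 := by
  have h := ProbabilityTheory.variance_id_gaussianReal (μ := 0) (v := 1)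
  rw [ProbabilityTheory.variance_eq_integral (by fun_prop)] at h
  simp only [id, ProbabilityTheory.integral_id_gaussianReal, sub_zero] at h
  rw [ProbabilityTheory.integral_gaussianReal_eq_integral_smul (by simp)] at h
  refine Eq.trans ?_ h
  refine integral_congr_ae (ae_of_all _ fun u => ?_)
  have := gaussD_sqrt_eq_gaussianPDFReal one_pos u
  rw [Real.sqrt_one] at this
  simp only [smul_eq_mul]
  rw [this, mul_comm]; rfl

theorem integral_Ioi_sq_mul_gaussD : ∫ u in Ioi (0 : ℝ), u ^ 2 * gaussD u 1 = 1 / 2 := by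
  have h := integral_comp_abs (f := fun u : ℝ => u ^ 2 * gaussD u 1)
  have h' : ∀ u : ℝ, |u| ^ 2 * gaussD |u| 1 = u ^ 2 * gaussD u 1 := fun u => by
    rw [sq_abs]
    rcases abs_choice u with h | h <;> rw [h]
    rw [gaussD_neg]
  simp_rw [h', integral_sq_mul_gaussD] at h
  linarith

theorem exists_quarter_le_integral_sq_mul_gaussD :
    ∃ M : ℝ, 0 < M ∧ 1 / 4 ≤ ∫ u in (0 : ℝ)..M, u ^ 2 * gaussD u 1 := by
  have h := intervalIntegral_tendsto_integral_Ioi (0 : ℝ)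
    integrable_sq_mul_gaussD.integrableOn tendsto_id
  rw [integral_Ioi_sq_mul_gaussD] at h
  have h1 := h.eventually (eventually_ge_nhds (show (1 / 4 : ℝ) < 1 / 2 by norm_num))
  obtain ⟨M, hM, hM0⟩ := (h1.and (eventually_gt_atTop 0)).exists
  exact ⟨M, hM0, hM⟩

section Density

variable {n : ℕ} {D t : ℝ}

theorem pEmp_pos (hn : 2 ≤ n) (ht : 0 < t) (x : ℝ) : 0 < pEmp n D t x := by
  unfold pEmp
  refine mul_pos (by positivity) (Finset.sum_pos (fun k _ => gaussD_pos _ (Real.sqrt_pos.2 ht)) ?_)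
  exact ⟨1, by simp; omega⟩

@[fun_prop]
theorem continuous_pEmp : Continuous (pEmp n D t) := by
  unfold pEmp; fun_prop

theorem gaussD_le_pEmp (hn : 2 ≤ n) (ht : 0 < t) {k : ℕ} (hk : k ∈ Finset.Icc 1 n) (x : ℝ) :
    (1 / (n : ℝ)) * gaussD (x - trainPt n D k) (√t) ≤ pEmp n D t x := by
  unfold pEmp
  refine mul_le_mul_of_nonneg_left ?_ (by positivity)
  exact Finset.single_le_sum (f := fun k => gaussD (x - trainPt n D k) (√t))
    (fun k _ => (gaussD_pos _ (Real.sqrt_pos.2 ht)).le) hk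

theorem hasDerivAt_gaussD_sub (ht : 0 < t) (y x : ℝ) :
    HasDerivAt (fun x => gaussD (x - y) (√t)) (gaussD (x - y) (√t) * ((y - x) / t)) x := by
  unfold gaussD
  rw [Real.sq_sqrt ht.le]
  have h1 : HasDerivAt (fun x : ℝ => -(x - y) ^ 2 / (2 * t)) ((y - x) / t) x := by
    have := ((((hasDerivAt_id x).sub_const y).pow 2).neg).div_const (2 * t)
    refine this.congr_deriv ?_
    simp only [id]
    field_simp
    ring
  refine (h1.exp.const_mul _).congr_deriv ?_
  ring

theorem hasDerivAt_pEmp (ht : 0 < t) (x : ℝ) :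
    HasDerivAt (pEmp n D t) ((1 / (n : ℝ)) * ∑ k ∈ Finset.Icc 1 n,
      gaussD (x - trainPt n D k) (√t) * ((trainPt n D k - x) / t)) x := by
  unfold pEmp
  exact (HasDerivAt.fun_sum fun k _ => hasDerivAt_gaussD_sub ht (trainPt n D k) x).const_mul _

theorem hasDerivAt_log_pEmp (hn : 2 ≤ n) (ht : 0 < t) (x : ℝ) :
    HasDerivAt (fun y => Real.log (pEmp n D t y)) (scoreEmp n D t x) x :=
  ((hasDerivAt_pEmp ht x).log (pEmp_pos hn ht x).ne').differentiableAt.hasDerivAt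

theorem scoreEmp_mul_pEmp (hn : 2 ≤ n) (ht : 0 < t) (x : ℝ) :
    scoreEmp n D t x * pEmp n D t x = (1 / (n : ℝ)) * ∑ k ∈ Finset.Icc 1 n,
      gaussD (x - trainPt n D k) (√t) * ((trainPt n D k - x) / t) := by
  have h := ((hasDerivAt_pEmp (n := n) (D := D) ht x).log (pEmp_pos hn ht x).ne').deriv
  unfold scoreEmp
  rw [h, div_mul_cancel₀ _ (pEmp_pos hn ht x).ne']

theorem continuous_scoreEmp (hn : 2 ≤ n) (ht : 0 < t) : Continuous (scoreEmp n D t) := by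
  have h : scoreEmp n D t = fun x => ((1 / (n : ℝ)) * ∑ k ∈ Finset.Icc 1 n,
      gaussD (x - trainPt n D k) (√t) * ((trainPt n D k - x) / t)) / pEmp n D t x := by
    funext x
    rw [eq_div_iff (pEmp_pos hn ht x).ne', scoreEmp_mul_pEmp hn ht]
  rw [h]
  exact Continuous.div (by fun_prop) (by fun_prop) fun x => (pEmp_pos hn ht x).ne'

theorem sub_scoreEmp_mul_pEmp (hn : 2 ≤ n) (ht : 0 < t) (x c : ℝ) :
    (c - scoreEmp n D t x) * pEmp n D t x = (1 / (n : ℝ)) * ∑ k ∈ Finset.Icc 1 n,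
      gaussD (x - trainPt n D k) (√t) * (c - (trainPt n D k - x) / t) := by
  rw [sub_mul, scoreEmp_mul_pEmp hn ht]
  simp only [mul_sub, Finset.sum_sub_distrib, ← Finset.sum_mul]
  unfold pEmp
  ring

/-- Jensen's inequality for the posterior mean. -/
theorem sq_sub_scoreEmp_mul_pEmp_le (hn : 2 ≤ n) (ht : 0 < t) (x c : ℝ) :
    (c - scoreEmp n D t x) ^ 2 * pEmp n D t x ≤ (1 / (n : ℝ)) * ∑ k ∈ Finset.Icc 1 n,
      gaussD (x - trainPt n D k) (√t) * (c - (trainPt n D k - x) / t) ^ 2 := by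
  have hp := pEmp_pos (D := D) hn ht x
  have hg : ∀ k, 0 < gaussD (x - trainPt n D k) (√t) := fun k => gaussD_pos _ (Real.sqrt_pos.2 ht)
  refine le_of_mul_le_mul_right ?_ hp
  have h : (c - scoreEmp n D t x) ^ 2 * pEmp n D t x * pEmp n D t x
      = ((c - scoreEmp n D t x) * pEmp n D t x) ^ 2 := by ring
  rw [h, sub_scoreEmp_mul_pEmp hn ht]
  have cs := Finset.sum_sq_le_sum_mul_sum_of_sq_le_mul (Finset.Icc 1 n)
    (r := fun k => gaussD (x - trainPt n D k) (√t) * (c - (trainPt n D k - x) / t))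
    (f := fun k => gaussD (x - trainPt n D k) (√t) * (c - (trainPt n D k - x) / t) ^ 2)
    (g := fun k => gaussD (x - trainPt n D k) (√t))
    (fun k _ => mul_nonneg (hg k).le (sq_nonneg _)) (fun k _ => (hg k).le) (fun k _ => le_of_eq (by ring))
  rw [mul_pow]
  unfold pEmp
  calc _ ≤ (1 / (n : ℝ)) ^ 2 * _ := mul_le_mul_of_nonneg_left cs (by positivity)
    _ = _ := by ring

/-- The empirical score is within `e` of `c` if all posterior deviations are. -/
theorem abs_sub_scoreEmp_le (hn : 2 ≤ n) (ht : 0 < t) (x c e : ℝ)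
    (h : ∑ k ∈ Finset.Icc 1 n, gaussD (x - trainPt n D k) (√t) * |c - (trainPt n D k - x) / t|
      ≤ e * ∑ k ∈ Finset.Icc 1 n, gaussD (x - trainPt n D k) (√t)) :
    |c - scoreEmp n D t x| ≤ e := by
  have hp := pEmp_pos (D := D) hn ht x
  have hg : ∀ k, 0 < gaussD (x - trainPt n D k) (√t) := fun k => gaussD_pos _ (Real.sqrt_pos.2 ht)
  refine le_of_mul_le_mul_right ?_ hp
  have h1 : |c - scoreEmp n D t x| * pEmp n D t x = |(c - scoreEmp n D t x) * pEmp n D t x| := by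
    rw [abs_mul, abs_of_pos hp]
  rw [h1, sub_scoreEmp_mul_pEmp hn ht, abs_mul, abs_of_nonneg (by positivity : 0 ≤ 1 / (n : ℝ))]
  unfold pEmp
  calc _ ≤ 1 / (n : ℝ) * ∑ k ∈ Finset.Icc 1 n,
        gaussD (x - trainPt n D k) (√t) * |c - (trainPt n D k - x) / t| := by
        refine mul_le_mul_of_nonneg_left ((Finset.abs_sum_le_sum_abs _ _).trans_eq ?_)
          (by positivity)
        refine Finset.sum_congr rfl fun k _ => ?_
        rw [abs_mul, abs_of_pos (hg k)]
    _ ≤ 1 / (n : ℝ) * _ := mul_le_mul_of_nonneg_left h (by positivity)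
    _ = _ := by ring

theorem abs_trainPt_le (hn : 2 ≤ n) (hD : 0 < D) {k : ℕ} (hk : k ∈ Finset.Icc 1 n) :
    |trainPt n D k| ≤ D := by
  rw [Finset.mem_Icc] at hk
  have h1 : (1 : ℝ) ≤ k := by exact_mod_cast hk.1
  have h2 : (k : ℝ) ≤ n := by exact_mod_cast hk.2
  have h3 : (2 : ℝ) ≤ n := by exact_mod_cast hn
  unfold trainPt
  have h4 : ((k : ℝ) - 1) * (D / (n - 1)) ≤ D := by
    rw [mul_div_assoc', div_le_iff₀ (by linarith)]
    nlinarith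
  have h5 : 0 ≤ ((k : ℝ) - 1) * (D / (n - 1)) :=
    mul_nonneg (by linarith) (div_nonneg hD.le (by linarith))
  rw [abs_le]; constructor <;> linarith

theorem abs_scoreEmp_le (hn : 2 ≤ n) (hD : 0 < D) (ht : 0 < t) (x : ℝ) :
    |scoreEmp n D t x| ≤ (D + |x|) / t := by
  have := abs_sub_scoreEmp_le (D := D) hn ht x 0 ((D + |x|) / t) ?_
  · simpa using this
  rw [Finset.mul_sum]
  refine Finset.sum_le_sum fun k hk => ?_
  rw [mul_comm]
  refine mul_le_mul_of_nonneg_right ?_ (gaussD_pos _ (Real.sqrt_pos.2 ht)).le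
  rw [zero_sub, abs_neg, abs_div, abs_of_pos ht]
  gcongr
  exact (abs_sub _ _).trans (add_le_add_left (abs_trainPt_le hn hD hk) _)

theorem trainPt_sub (n : ℕ) (D : ℝ) (j k : ℕ) :
    trainPt n D j - trainPt n D k = 2 * ((j : ℝ) - k) * (D / ((n : ℝ) - 1)) := by
  unfold trainPt; ring

/-- Near a training point the empirical score is exponentially close to the score of a single
Gaussian. -/
theorem abs_sub_scoreEmp_near_le (hn : 2 ≤ n) (hD : 0 < D) (ht : 0 < t) {k : ℕ}
    (hk : k ∈ Finset.Icc 1 n) {x : ℝ} (hx : |x - trainPt n D k| ≤ D / ((n : ℝ) - 1) / 2) :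
    |(trainPt n D k - x) / t - scoreEmp n D t x| ≤
      2 * D * n / t * Real.exp (-(D / ((n : ℝ) - 1)) ^ 2 / t) := by
  set Δ := D / ((n : ℝ) - 1) with hΔ
  have h3 : (2 : ℝ) ≤ n := by exact_mod_cast hn
  have hΔ0 : 0 < Δ := div_pos hD (by linarith)
  have hg : ∀ k, 0 < gaussD (x - trainPt n D k) (√t) := fun k => gaussD_pos _ (Real.sqrt_pos.2 ht)
  refine abs_sub_scoreEmp_le hn ht x _ _ ?_
  have hterm : ∀ j ∈ Finset.Icc 1 n, gaussD (x - trainPt n D j) (√t) *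
      |(trainPt n D k - x) / t - (trainPt n D j - x) / t| ≤
      gaussD (x - trainPt n D k) (√t) * (2 * D / t * Real.exp (-Δ ^ 2 / t)) := by
    intro j hj
    rcases eq_or_ne j k with rfl | hjk
    · simp only [sub_self, abs_zero, mul_zero]
      exact mul_nonneg (hg j).le (by positivity)
    have hdist : |(trainPt n D k - x) / t - (trainPt n D j - x) / t| ≤ 2 * D / t := by
      rw [← sub_div, abs_div, abs_of_pos ht]
      gcongr
      have := abs_le.1 (abs_trainPt_le hn hD hj)
      have := abs_le.1 (abs_trainPt_le hn hD hk)
      rw [abs_le]; constructor <;> linarith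
    have hgj : gaussD (x - trainPt n D j) (√t) ≤
        gaussD (x - trainPt n D k) (√t) * Real.exp (-Δ ^ 2 / t) := by
      unfold gaussD
      rw [mul_assoc, ← Real.exp_add, Real.sq_sqrt ht.le]
      refine mul_le_mul_of_nonneg_left (Real.exp_le_exp.2 ?_) (by positivity)
      have hsq : (x - trainPt n D k) ^ 2 + 2 * Δ ^ 2 ≤ (x - trainPt n D j) ^ 2 := by
        have habs := abs_le.1 hx
        have hs := trainPt_sub n D j k
        rw [← hΔ] at hs
        rcases lt_or_gt_of_ne hjk with h | h
        · have : (j : ℝ) + 1 ≤ k := by exact_mod_cast h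
          have h2 : trainPt n D j - trainPt n D k ≤ -2 * Δ := by rw [hs]; nlinarith
          nlinarith
        · have : (k : ℝ) + 1 ≤ j := by exact_mod_cast h
          have h2 : 2 * Δ ≤ trainPt n D j - trainPt n D k := by rw [hs]; nlinarith
          nlinarith
      rw [← sub_nonneg]
      have : -(x - trainPt n D k) ^ 2 / (2 * t) + -Δ ^ 2 / t - -(x - trainPt n D j) ^ 2 / (2 * t)
        = ((x - trainPt n D j) ^ 2 - ((x - trainPt n D k) ^ 2 + 2 * Δ ^ 2)) / (2 * t) := by
        field_simp; ring
      rw [this]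
      exact div_nonneg (by linarith) (by positivity)
    calc _ ≤ (gaussD (x - trainPt n D k) (√t) * Real.exp (-Δ ^ 2 / t)) * (2 * D / t) :=
          mul_le_mul hgj hdist (abs_nonneg _) (mul_nonneg (hg k).le (Real.exp_pos _).le)
      _ = _ := by ring
  calc _ ≤ ∑ j ∈ Finset.Icc 1 n,
        gaussD (x - trainPt n D k) (√t) * (2 * D / t * Real.exp (-Δ ^ 2 / t)) :=
        Finset.sum_le_sum hterm
    _ = 2 * D * n / t * Real.exp (-Δ ^ 2 / t) * gaussD (x - trainPt n D k) (√t) := by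
        rw [Finset.sum_const, Nat.card_Icc, nsmul_eq_mul]
        simp only [Nat.add_sub_cancel]
        ring
    _ ≤ _ := mul_le_mul_of_nonneg_left (Finset.single_le_sum
        (f := fun k => gaussD (x - trainPt n D k) (√t)) (fun k _ => (hg k).le) hk) (by positivity)

end Density

theorem sq_div_add_sq_lower {a b x e : ℝ} (hx : 0 ≤ x) (he : 0 ≤ e) (h : 2 * (x - e) ≤ a - b) :
    8 / 5 * x ^ 2 - 8 * e ^ 2 ≤ a ^ 2 + b ^ 2 := by
  rcases le_total x e with hxe | hxe
  · nlinarith [sq_nonneg a, sq_nonneg b]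
  · have h1 : (2 * (x - e)) ^ 2 ≤ (a - b) ^ 2 := pow_le_pow_left₀ (by linarith) h 2
    nlinarith [sq_nonneg (a + b), sq_nonneg (x - 5 * e)]

/-- If the odd part of `B` grows at least linearly with slope `s`, up to an error `e`, then its
Gaussian second moment controls `s`. -/
theorem sq_slope_le_integral {B : ℝ → ℝ} (hB : Continuous B) {M s e : ℝ} (hM : 0 < M)
    (hs : 0 ≤ s) (he : 0 ≤ e) (hv : 1 / 4 ≤ ∫ u in (0 : ℝ)..M, u ^ 2 * gaussD u 1)
    (h : ∀ u ∈ Icc 0 M, 2 * (s * u - e) ≤ B u - B (-u)) :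
    2 / 5 * s ^ 2 - 8 * e ^ 2 ≤ ∫ u in (-(2 * M))..(2 * M), B u ^ 2 * gaussD u 1 := by
  have hφ : ∀ u, 0 < gaussD u 1 := fun u => gaussD_pos u one_pos
  have hc : Continuous fun u => B u ^ 2 * gaussD u 1 := by fun_prop
  have hc' : Continuous fun u => B (-u) ^ 2 * gaussD u 1 := by fun_prop
  have h1 : ∫ u in (-M)..M, B u ^ 2 * gaussD u 1 ≤
      ∫ u in (-(2 * M))..(2 * M), B u ^ 2 * gaussD u 1 :=
    intervalIntegral.integral_mono_interval (by linarith) (by linarith) (by linarith)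
      (ae_of_all _ fun u => mul_nonneg (sq_nonneg _) (hφ u).le) (hc.intervalIntegrable _ _)
  have h2 : ∫ u in (-M)..M, B u ^ 2 * gaussD u 1 =
      ∫ u in (0 : ℝ)..M, (B u ^ 2 * gaussD u 1 + B (-u) ^ 2 * gaussD u 1) := by
    rw [intervalIntegral.integral_add (hc.intervalIntegrable _ _) (hc'.intervalIntegrable _ _),
      ← intervalIntegral.integral_add_adjacent_intervals (hc.intervalIntegrable (-M) 0)
        (hc.intervalIntegrable 0 M), add_comm]
    congr 1
    have := intervalIntegral.integral_comp_neg (a := 0) (b := M)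
      (fun u => B u ^ 2 * gaussD u 1)
    simp only [gaussD_neg, neg_zero] at this
    exact this.symm
  have h3 : ∫ u in (0 : ℝ)..M, (8 / 5 * s ^ 2 * (u ^ 2 * gaussD u 1) - 8 * e ^ 2 * gaussD u 1) ≤
      ∫ u in (0 : ℝ)..M, (B u ^ 2 * gaussD u 1 + B (-u) ^ 2 * gaussD u 1) := by
    refine intervalIntegral.integral_mono_on hM.le ?_ ?_ fun u hu => ?_
    · exact Continuous.intervalIntegrable (by fun_prop) _ _
    · exact Continuous.intervalIntegrable (by fun_prop) _ _
    · have := sq_div_add_sq_lower (mul_nonneg hs hu.1) he (h u hu)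
      nlinarith [hφ u]
  have h4 : ∫ u in (0 : ℝ)..M, gaussD u 1 ≤ 1 := by
    rw [intervalIntegral.integral_of_le hM.le]
    exact (setIntegral_le_integral integrable_gaussD_one
      (ae_of_all _ fun u => (hφ u).le)).trans_eq integral_gaussD_one
  rw [intervalIntegral.integral_sub (Continuous.intervalIntegrable (by fun_prop) _ _)
    (Continuous.intervalIntegrable (by fun_prop) _ _), intervalIntegral.integral_const_mul,
    intervalIntegral.integral_const_mul] at h3
  nlinarith [sq_nonneg s, sq_nonneg e]

theorem exists_sq_mul_le_integral {B : ℝ → ℝ} (hB : Continuous B) {M a b : ℝ} (hM : 0 < M)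
    (hab : b - a = M) (ha : -(2 * M) ≤ a) (hb : b ≤ 2 * M) :
    ∃ u ∈ Icc a b, B u ^ 2 * (M * gaussD (2 * M) 1) ≤
      ∫ u in (-(2 * M))..(2 * M), B u ^ 2 * gaussD u 1 := by
  have hφ : ∀ u, 0 < gaussD u 1 := fun u => gaussD_pos u one_pos
  have hc : Continuous fun u => B u ^ 2 * gaussD u 1 := by fun_prop
  have hab' : a ≤ b := by linarith
  obtain ⟨u₀, hu₀, hmin⟩ := isCompact_Icc.exists_isMinOn (nonempty_Icc.2 hab')
    (f := fun u => B u ^ 2) (by fun_prop)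
  refine ⟨u₀, hu₀, ?_⟩
  calc B u₀ ^ 2 * (M * gaussD (2 * M) 1) = ∫ _u in a..b, B u₀ ^ 2 * gaussD (2 * M) 1 := by
        rw [intervalIntegral.integral_const, hab, smul_eq_mul]; ring
    _ ≤ ∫ u in a..b, B u ^ 2 * gaussD u 1 := by
        refine intervalIntegral.integral_mono_on hab' (by simp) (hc.intervalIntegrable _ _)
          fun u hu => ?_
        refine mul_le_mul (hmin hu) ?_ (hφ _).le (sq_nonneg _)
        unfold gaussD
        refine mul_le_mul_of_nonneg_left (Real.exp_le_exp.2 ?_) (by positivity)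
        have h1 := hu.1
        have h2 := hu.2
        have : u ^ 2 ≤ (2 * M) ^ 2 := by nlinarith
        linarith
    _ ≤ _ := intervalIntegral.integral_mono_interval ha hab' hb
      (ae_of_all _ fun u => mul_nonneg (sq_nonneg _) (hφ u).le) (hc.intervalIntegrable _ _)

/-- The local contribution of one training point to the loss, in rescaled coordinates. -/
theorem integral_rescaled_le {n : ℕ} {D t : ℝ} (hn : 2 ≤ n) (ht : 0 < t) {A : ℝ → ℝ}
    (hA : Continuous A) {k : ℕ} (hk : k ∈ Finset.Icc 1 n) {L : ℝ} (hL : 0 ≤ L) :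
    ∫ u in (-L)..L, (√t * A (trainPt n D k + √t * u)) ^ 2 * gaussD u 1 ≤
      n * (t * ∫ x in (trainPt n D k - √t * L)..(trainPt n D k + √t * L),
        A x ^ 2 * pEmp n D t x) := by
  set y := trainPt n D k with hy
  have hst : 0 < √t := Real.sqrt_pos.2 ht
  have hn0 : (0 : ℝ) < n := by exact_mod_cast (by omega : 0 < n)
  have h1 : ∫ x in (y - √t * L)..(y + √t * L), A x ^ 2 * (1 / (n : ℝ) * gaussD (x - y) (√t)) ≤
      ∫ x in (y - √t * L)..(y + √t * L), A x ^ 2 * pEmp n D t x := by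
    refine intervalIntegral.integral_mono_on (by nlinarith [mul_nonneg hst.le hL]) ?_ ?_
      fun x _ => ?_
    · exact Continuous.intervalIntegrable (by fun_prop) _ _
    · exact Continuous.intervalIntegrable (by fun_prop) _ _
    · exact mul_le_mul_of_nonneg_left (gaussD_le_pEmp hn ht hk x) (sq_nonneg _)
  have h2 := intervalIntegral.mul_integral_comp_add_mul (a := -L) (b := L)
    (f := fun x => A x ^ 2 * (1 / (n : ℝ) * gaussD (x - y) (√t))) (√t) y
  rw [mul_neg, ← sub_eq_add_neg] at h2
  rw [← h2] at h1
  calc _ = n * (t * (√t * ∫ u in (-L)..L, A (y + √t * u) ^ 2 *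
        (1 / (n : ℝ) * gaussD (y + √t * u - y) (√t)))) := by
        rw [← intervalIntegral.integral_const_mul, ← intervalIntegral.integral_const_mul,
          ← intervalIntegral.integral_const_mul]
        congr 1
        funext u
        rw [add_sub_cancel_left, gaussD_sqrt_mul ht, mul_pow, Real.sq_sqrt ht.le]
        field_simp
    _ ≤ _ := by gcongr

section Windows

variable {n : ℕ} {D t M : ℝ}

theorem sum_window_integral_le (hn : 2 ≤ n) (hD : 0 < D) {h : ℝ → ℝ} (hi : Integrable h)
    (h0 : ∀ x, 0 ≤ h x) {W : ℝ} (hW0 : 0 ≤ W) (hW : W ≤ D / ((n : ℝ) - 1)) :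
    ∑ k ∈ Finset.range n, ∫ x in (trainPt n D (k + 1) - W)..(trainPt n D (k + 1) + W), h x
      ≤ ∫ x, h x := by
  have h3 : (2 : ℝ) ≤ n := by exact_mod_cast hn
  have hΔ0 : 0 < D / ((n : ℝ) - 1) := div_pos hD (by linarith)
  have h1 : ∀ k ∈ Finset.range n,
      ∫ x in (trainPt n D (k + 1) - W)..(trainPt n D (k + 1) + W), h x =
      ∫ x in Ioc (trainPt n D (k + 1) - W) (trainPt n D (k + 1) + W), h x := fun k _ =>
    intervalIntegral.integral_of_le (by linarith)
  rw [Finset.sum_congr rfl h1, ← integral_biUnion_finset]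
  · exact setIntegral_le_integral hi (ae_of_all _ h0)
  · exact fun _ _ => measurableSet_Ioc
  · have key : ∀ i j : ℕ, i < j → Disjoint (Ioc (trainPt n D (i + 1) - W) (trainPt n D (i + 1) + W))
        (Ioc (trainPt n D (j + 1) - W) (trainPt n D (j + 1) + W)) := by
      intro i j hij
      refine Set.disjoint_left.2 fun x hx hx' => ?_
      have hs := trainPt_sub n D (j + 1) (i + 1)
      have : (i : ℝ) + 1 ≤ j := by exact_mod_cast hij
      push_cast at hs
      have h5 : 2 * (D / ((n : ℝ) - 1)) ≤ trainPt n D (j + 1) - trainPt n D (i + 1) := by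
        rw [hs]; nlinarith
      linarith [hx.2, hx'.1]
    intro i _ j _ hij
    rcases lt_or_gt_of_ne hij with h | h
    · exact key i j h
    · exact (key j i h).symm
  · exact fun _ _ => hi.integrableOn

end Windows

section OneDim

variable {n : ℕ} {D t M e : ℝ} {f : ℝ → ℝ}

theorem abs_scaled_scoreEmp_add_le (hn : 2 ≤ n) (hD : 0 < D) (ht : 0 < t)
    (he : √t * (2 * D * n / t * Real.exp (-(D / ((n : ℝ) - 1)) ^ 2 / t)) ≤ e)
    {k : ℕ} (hk : k ∈ Finset.Icc 1 n) {u : ℝ} (hu : √t * |u| ≤ D / ((n : ℝ) - 1) / 2) :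
    |√t * scoreEmp n D t (trainPt n D k + √t * u) + u| ≤ e := by
  have hst : 0 < √t := Real.sqrt_pos.2 ht
  have h := abs_sub_scoreEmp_near_le hn hD ht hk (x := trainPt n D k + √t * u)
    (by rwa [add_sub_cancel_left, abs_mul, abs_of_pos hst])
  have h2 := mul_le_mul_of_nonneg_left h hst.le
  refine le_trans ?_ (h2.trans he)
  rw [← abs_of_pos hst, ← abs_mul, abs_of_pos hst, ← abs_neg]
  refine le_of_eq (congrArg _ ?_)
  have : t = √t * √t := (Real.mul_self_sqrt ht.le).symm
  have h3 : √t * ((trainPt n D k - (trainPt n D k + √t * u)) / t) = -u := by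
    have h4 : trainPt n D k - (trainPt n D k + √t * u) = -(√t * u) := by ring
    rw [h4, mul_div_assoc', div_eq_iff ht.ne']
    linear_combination u * this
  rw [mul_sub, h3]
  ring

/-- Near each training point some derivative of `f` is close to `-1/t`. -/
theorem exists_deriv_le_near_trainPt (hn : 2 ≤ n) (hD : 0 < D) (ht : 0 < t) (hM : 0 < M)
    (hv : 1 / 4 ≤ ∫ u in (0 : ℝ)..M, u ^ 2 * gaussD u 1)
    (hMt : √t * (2 * M) ≤ D / ((n : ℝ) - 1) / 2) (he0 : 0 ≤ e)
    (he : √t * (2 * D * n / t * Real.exp (-(D / ((n : ℝ) - 1)) ^ 2 / t)) ≤ e)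
    (hf : Continuous f) {S : Set ℝ} (hS : S.Finite) (hd : ∀ x ∉ S, DifferentiableAt ℝ f x)
    {k : ℕ} (hk : k ∈ Finset.Icc 1 n) {s : ℝ} (hs : 0 ≤ s)
    (hsI : 5 / 2 * (n * (t * ∫ x in (trainPt n D k - √t * (2 * M))..(trainPt n D k + √t * (2 * M)),
        (f x - scoreEmp n D t x) ^ 2 * pEmp n D t x)) + 20 * e ^ 2 < s ^ 2) :
    ∃ p ∉ S, |p - trainPt n D k| < √t * M ∧ t * deriv f p ≤ -(1 - s) := by
  have hst : 0 < √t := Real.sqrt_pos.2 ht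
  have htt : √t * √t = t := Real.mul_self_sqrt ht.le
  have hcs := continuous_scoreEmp (D := D) hn ht
  by_contra! hcon
  set Y := trainPt n D k with hY
  have hI := integral_rescaled_le hn ht (A := fun x => f x - scoreEmp n D t x) (by fun_prop) hk
    (L := 2 * M) (D := D) (by positivity)
  have hI2 := sq_slope_le_integral (B := fun u => √t * (f (Y + √t * u) -
    scoreEmp n D t (Y + √t * u))) (by fun_prop) hM hs he0 hv ?_
  · rw [← hY] at hI
    linarith
  intro u hu
  have hu1 := hu.1
  have hu2 := hu.2
  have e1 : √t * |u| ≤ D / ((n : ℝ) - 1) / 2 := by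
    rw [abs_of_nonneg hu1]; nlinarith
  have hp := abs_le.1 (abs_scaled_scoreEmp_add_le hn hD ht he hk e1)
  have hm := abs_le.1 (abs_scaled_scoreEmp_add_le hn hD ht he hk (u := -u) (by rwa [abs_neg]))
  rw [← hY] at hp hm
  have hfl : -(2 * (1 - s) * u) ≤ √t * f (Y + √t * u) - √t * f (Y + √t * -u) := by
    rcases hu1.eq_or_lt with rfl | hu0
    · simp
    have hsu : 0 < √t * u := mul_pos hst hu0
    obtain ⟨c, hc, hcS, hslope⟩ := exists_deriv_le_slope hf hS hd
      (show Y + √t * -u < Y + √t * u by linarith)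
    have hcd := hcon c hcS (by
      have : √t * u ≤ √t * M := mul_le_mul_of_nonneg_left hu2 hst.le
      rw [abs_lt]; constructor <;> linarith [hc.1, hc.2])
    have h1 : √t * (deriv f c * (Y + √t * u - (Y + √t * -u))) = 2 * (t * deriv f c) * u := by
      linear_combination 2 * deriv f c * u * htt
    have h2 := mul_le_mul_of_nonneg_left hslope hst.le
    rw [h1] at h2
    nlinarith
  linarith [hp.1, hp.2, hm.1, hm.2]

/-- On each side of a training point `f` takes a value of order `1/√t`. -/
theorem exists_abs_le_near_trainPt (hn : 2 ≤ n) (hD : 0 < D) (ht : 0 < t) (hM : 0 < M)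
    (hMt : √t * (2 * M) ≤ D / ((n : ℝ) - 1) / 2) (he1 : e ≤ 1)
    (he : √t * (2 * D * n / t * Real.exp (-(D / ((n : ℝ) - 1)) ^ 2 / t)) ≤ e)
    (hf : Continuous f) {k : ℕ} (hk : k ∈ Finset.Icc 1 n) {ε : ℝ}
    (hI : t * ∫ x in (trainPt n D k - √t * (2 * M))..(trainPt n D k + √t * (2 * M)),
        (f x - scoreEmp n D t x) ^ 2 * pEmp n D t x ≤ ε) {a b : ℝ}
    (hab : b - a = M) (ha : -(2 * M) ≤ a) (hb : b ≤ 2 * M) :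
    ∃ u ∈ Icc a b, √t * |f (trainPt n D k + √t * u)| ≤
      √(n * ε / (M * gaussD (2 * M) 1)) + 2 * M + 1 := by
  have hst : 0 < √t := Real.sqrt_pos.2 ht
  have hcs := continuous_scoreEmp (D := D) hn ht
  set Y := trainPt n D k with hY
  have hm : 0 < M * gaussD (2 * M) 1 := mul_pos hM (gaussD_pos _ one_pos)
  obtain ⟨u, hu, h⟩ := exists_sq_mul_le_integral (B := fun u => √t * (f (Y + √t * u) -
    scoreEmp n D t (Y + √t * u))) (by fun_prop) hM hab ha hb
  refine ⟨u, hu, ?_⟩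
  have h1 := integral_rescaled_le hn ht (A := fun x => f x - scoreEmp n D t x) (by fun_prop) hk
    (L := 2 * M) (D := D) (by positivity)
  have h2 : (√t * (f (Y + √t * u) - scoreEmp n D t (Y + √t * u))) ^ 2 ≤
      n * ε / (M * gaussD (2 * M) 1) := by
    rw [le_div_iff₀ hm]
    refine h.trans (h1.trans ?_)
    exact mul_le_mul_of_nonneg_left hI (by positivity)
  have h3 := Real.abs_le_sqrt h2
  have huM : |u| ≤ 2 * M := abs_le.2 ⟨by linarith [hu.1], by linarith [hu.2]⟩
  have h4 := abs_scaled_scoreEmp_add_le hn hD ht he hk (u := u)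
    (le_trans (mul_le_mul_of_nonneg_left huM hst.le) hMt)
  rw [← hY] at h4
  rw [← abs_of_pos hst, ← abs_mul, abs_of_pos hst]
  have h5 : √t * f (Y + √t * u) = √t * (f (Y + √t * u) - scoreEmp n D t (Y + √t * u)) +
    ((√t * scoreEmp n D t (Y + √t * u) + u) + -u) := by ring
  rw [h5]
  refine (abs_add_le _ _).trans ?_
  have h6 := abs_add_le (√t * scoreEmp n D t (Y + √t * u) + u) (-u)
  rw [abs_neg] at h6
  linarith

/-- A low-loss function has a derivative that oscillates at all training points. -/
theorem exists_oscillation_of_loss_lt (hn : 2 ≤ n) (hD : 0 < D) (ht : 0 < t) (hM : 0 < M)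
    (hv : 1 / 4 ≤ ∫ u in (0 : ℝ)..M, u ^ 2 * gaussD u 1)
    (hMt : √t * (2 * M) ≤ D / ((n : ℝ) - 1) / 2) (he0 : 0 ≤ e) (he1 : e ≤ 1)
    (he : √t * (2 * D * n / t * Real.exp (-(D / ((n : ℝ) - 1)) ^ 2 / t)) ≤ e)
    {ε : ℝ} (hε : 0 < ε) (heε : 20 * e ^ 2 < ε / 2)
    (hf : Continuous f) {S : Set ℝ} (hS : S.Finite) (hd : ∀ x ∉ S, DifferentiableAt ℝ f x)
    (hint : Integrable fun x => (f x - scoreEmp n D t x) ^ 2 * pEmp n D t x)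
    (hloss : t * ∫ x, (f x - scoreEmp n D t x) ^ 2 * pEmp n D t x < ε) :
    ∃ p q : ℕ → ℝ, (∀ k ≤ n - 1, p k ∉ S) ∧ (∀ k < n - 1, q k ∉ S) ∧
      (∀ k < n - 1, p k ≤ q k) ∧ (∀ k < n - 1, q k ≤ p (k + 1)) ∧
      2 * ((n : ℝ) - 1) / t * (1 - 2 * √3 * √ε - 2 * (√(n * ε / (M * gaussD (2 * M) 1)) + 2 * M + 1)
        * √t / (D / ((n : ℝ) - 1))) ≤
      ∑ k ∈ Finset.range (n - 1), ((deriv f (q k) - deriv f (p k)) +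
        (deriv f (q k) - deriv f (p (k + 1)))) := by
  have hst : 0 < √t := Real.sqrt_pos.2 ht
  have htt : √t * √t = t := Real.mul_self_sqrt ht.le
  have hn3 : (2 : ℝ) ≤ n := by exact_mod_cast hn
  set Δ := D / ((n : ℝ) - 1) with hΔ
  have hΔ0 : 0 < Δ := div_pos hD (by linarith)
  set K := √(n * ε / (M * gaussD (2 * M) 1)) + 2 * M + 1 with hK
  have hK0 : 0 < K := by positivity
  set h : ℝ → ℝ := fun x => (f x - scoreEmp n D t x) ^ 2 * pEmp n D t x with hh
  have h0 : ∀ x, 0 ≤ h x := fun x => mul_nonneg (sq_nonneg _) (pEmp_pos hn ht x).le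
  set Y : ℕ → ℝ := fun k => trainPt n D (k + 1) with hY
  have hYs : ∀ k, Y (k + 1) - Y k = 2 * Δ := fun k => by
    have := trainPt_sub n D (k + 1 + 1) (k + 1)
    push_cast at this
    simp only [hY]
    rw [this]; ring
  have hmem : ∀ k < n, k + 1 ∈ Finset.Icc 1 n := fun k hk => by
    rw [Finset.mem_Icc]; omega
  let ℓ : ℕ → ℝ := fun k => t * ∫ x in (Y k - √t * (2 * M))..(Y k + √t * (2 * M)), h x
  have hℓ0 : ∀ k, 0 ≤ ℓ k := fun k => mul_nonneg ht.le
    (intervalIntegral.integral_nonneg (by nlinarith) fun x _ => h0 x)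
  have hsum : ∑ k ∈ Finset.range n, ℓ k < ε := by
    refine lt_of_le_of_lt ?_ hloss
    rw [← Finset.mul_sum]
    exact mul_le_mul_of_nonneg_left
      (sum_window_integral_le hn hD hint h0 (by positivity) (by linarith)) ht.le
  have hℓε : ∀ k < n, ℓ k ≤ ε := fun k hk => by
    refine le_trans ?_ hsum.le
    exact Finset.single_le_sum (fun i _ => hℓ0 i) (Finset.mem_range.2 hk)
  let s : ℕ → ℝ := fun k => √(5 / 2 * (n * ℓ k) + ε / 2)
  have hs0 : ∀ k, 0 ≤ s k := fun k => Real.sqrt_nonneg _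
  have hsq : ∀ k, s k ^ 2 = 5 / 2 * (n * ℓ k) + ε / 2 := fun k =>
    Real.sq_sqrt (by have := hℓ0 k; positivity)
  have hssum : ∑ k ∈ Finset.range n, s k ≤ n * (√3 * √ε) := by
    have h1 := sq_sum_le_card_mul_sum_sq (s := Finset.range n) (f := s)
    rw [Finset.card_range] at h1
    have h2 : ∑ k ∈ Finset.range n, s k ^ 2 ≤ n * (3 * ε) := by
      simp_rw [hsq]
      rw [Finset.sum_add_distrib, ← Finset.mul_sum, ← Finset.mul_sum, Finset.sum_const,
        Finset.card_range, nsmul_eq_mul]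
      have : (n : ℝ) * ∑ k ∈ Finset.range n, ℓ k ≤ n * ε :=
        mul_le_mul_of_nonneg_left hsum.le (by linarith)
      linarith
    refine abs_le_of_sq_le_sq' ?_ (by positivity) |>.2
    rw [mul_pow, mul_pow, Real.sq_sqrt (by norm_num), Real.sq_sqrt hε.le]
    nlinarith
  have hpex : ∀ k, ∃ p, k < n → p ∉ S ∧ |p - Y k| < √t * M ∧ t * deriv f p ≤ -(1 - s k) := by
    intro k
    by_cases hk : k < n
    · obtain ⟨p, hp⟩ := exists_deriv_le_near_trainPt hn hD ht hM hv hMt he0 he hf hS hd (hmem k hk)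
        (hs0 k) (by
          rw [hsq]
          change 5 / 2 * (n * ℓ k) + 20 * e ^ 2 < 5 / 2 * (n * ℓ k) + ε / 2
          linarith)
      exact ⟨p, fun _ => hp⟩
    · exact ⟨0, fun h => absurd h hk⟩
  choose p hp using hpex
  have hqex : ∀ k, ∃ q, k + 1 < n → q ∉ S ∧ Y k + √t * M ≤ q ∧ q ≤ Y (k + 1) - √t * M ∧
      -(2 * K * √t / Δ) ≤ t * deriv f q := by
    intro k
    by_cases hk : k + 1 < n
    · obtain ⟨u, hu, hfu⟩ := exists_abs_le_near_trainPt hn hD ht hM hMt he1 he hf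
        (hmem k (by omega)) (hℓε k (by omega)) (a := M) (b := 2 * M) (by ring) (by linarith) le_rfl
      obtain ⟨v, hv, hfv⟩ := exists_abs_le_near_trainPt hn hD ht hM hMt he1 he hf
        (hmem (k + 1) hk) (hℓε (k + 1) hk) (a := -(2 * M)) (b := -M) (by ring) le_rfl (by linarith)
      rw [← hK] at hfu hfv
      have hu1 : √t * M ≤ √t * u := mul_le_mul_of_nonneg_left hu.1 hst.le
      have hu2 : √t * u ≤ √t * (2 * M) := mul_le_mul_of_nonneg_left hu.2 hst.le
      have hv1 : √t * -(2 * M) ≤ √t * v := mul_le_mul_of_nonneg_left hv.1 hst.le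
      have hv2 : √t * v ≤ √t * -M := mul_le_mul_of_nonneg_left hv.2 hst.le
      have hgap : Δ ≤ Y (k + 1) + √t * v - (Y k + √t * u) := by
        have := hYs k
        linarith
      obtain ⟨q, hq, hqS, hslope⟩ := exists_slope_le_deriv hf hS hd
        (show Y k + √t * u < Y (k + 1) + √t * v by linarith)
      refine ⟨q, fun _ => ⟨hqS, by linarith [hq.1], by linarith [hq.2], ?_⟩⟩
      have hfu' : √t * f (Y k + √t * u) ≤ K :=
        (mul_le_mul_of_nonneg_left (le_abs_self _) hst.le).trans hfu
      have hfv' : -K ≤ √t * f (Y (k + 1) + √t * v) := by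
        have := mul_le_mul_of_nonneg_left (neg_abs_le (f (Y (k + 1) + √t * v))) hst.le
        have hfv'' : √t * |f (Y (k + 1) + √t * v)| ≤ K := hfv
        linarith
      have h7 := mul_le_mul_of_nonneg_left hslope hst.le
      have h8 : -(2 * K) ≤ √t * (deriv f q *
        (Y (k + 1) + √t * v - (Y k + √t * u))) := by linarith
      rw [neg_le, ← sub_nonneg]
      rw [show 2 * K * √t / Δ - -(t * deriv f q) = √t * (2 * K + √t * (deriv f q * Δ)) / Δ by
        have h9 : √t * (2 * K + √t * (deriv f q * Δ)) = 2 * K * √t + t * deriv f q * Δ := by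
          linear_combination deriv f q * Δ * htt
        rw [h9]; field_simp; ring]
      refine div_nonneg (mul_nonneg hst.le ?_) hΔ0.le
      rcases le_total 0 (deriv f q) with hpos | hneg
      · positivity
      · have : deriv f q * (Y (k + 1) + √t * v - (Y k + √t * u)) ≤ deriv f q * Δ :=
          mul_le_mul_of_nonpos_left hgap hneg
        have := mul_le_mul_of_nonneg_left this hst.le
        linarith
    · exact ⟨0, fun h => absurd h hk⟩
  choose q hq using hqex
  refine ⟨p, q, fun k hk => (hp k (by omega)).1, fun k hk => (hq k (by omega)).1,
    fun k hk => ?_, fun k hk => ?_, ?_⟩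
  · have := (abs_lt.1 (hp k (by omega)).2.1).2
    linarith [(hq k (by omega)).2.1]
  · have := (abs_lt.1 (hp (k + 1) (by omega)).2.1).1
    linarith [(hq k (by omega)).2.2.1]
  set τ := 2 * K * √t / Δ with hτ
  have hterm : ∀ k ∈ Finset.range (n - 1), (2 * (1 - τ) - s k - s (k + 1)) / t ≤
      (deriv f (q k) - deriv f (p k)) + (deriv f (q k) - deriv f (p (k + 1))) := by
    intro k hk
    rw [Finset.mem_range] at hk
    rw [div_le_iff₀ ht]
    have h1 := (hp k (by omega)).2.2
    have h2 := (hp (k + 1) (by omega)).2.2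
    have h3 := (hq k (by omega)).2.2.2
    linarith
  refine le_trans ?_ (Finset.sum_le_sum hterm)
  rw [← Finset.sum_div, Finset.sum_sub_distrib, Finset.sum_sub_distrib, Finset.sum_const,
    Finset.card_range, nsmul_eq_mul, Nat.cast_sub (by omega), Nat.cast_one, div_mul_eq_mul_div]
  refine div_le_div_of_nonneg_right ?_ ht.le
  have hn1 : n - 1 + 1 = n := by omega
  have h1 : ∑ k ∈ Finset.range (n - 1), s k ≤ ∑ k ∈ Finset.range n, s k :=
    Finset.sum_le_sum_of_subset_of_nonneg (Finset.range_mono (by omega)) fun i _ _ => hs0 i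
  have h2 : ∑ k ∈ Finset.range (n - 1), s (k + 1) ≤ ∑ k ∈ Finset.range n, s k := by
    rw [← hn1, Finset.sum_range_succ']
    simp only [hn1]
    linarith [hs0 0]
  have h3 : (n : ℝ) * (√3 * √ε) ≤ 2 * (n - 1) * (√3 * √ε) :=
    mul_le_mul_of_nonneg_right (by linarith) (by positivity)
  linarith

end OneDim

section Shat

variable {n : ℕ} {D t δ : ℝ} {s : ℝ → ℝ}

theorem trainPt_succ (n : ℕ) (D : ℝ) (m : ℕ) :
    trainPt n D (m + 1) = 2 * (m * (D / ((n : ℝ) - 1))) - D := by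
  unfold trainPt; push_cast; ring

theorem mul_step_le {j m : ℕ} (h : j < m) {Δ : ℝ} (hΔ : 0 ≤ Δ) : (j : ℝ) * Δ + Δ ≤ m * Δ := by
  have : (j : ℝ) + 1 ≤ m := by exact_mod_cast h
  nlinarith

theorem mul_le_of_le {j m : ℕ} (h : j ≤ m) {Δ : ℝ} (hΔ : 0 ≤ Δ) : (j : ℝ) * Δ ≤ m * Δ :=
  mul_le_mul_of_nonneg_right (by exact_mod_cast h) hΔ

theorem IsShat.eq_plateau (hs : IsShat n D t δ s) (hn : 2 ≤ n) {m : ℕ} (hm : m ≤ n - 1) {x : ℝ}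
    (h1 : m = 0 ∨ trainPt n D (m + 1) - δ ≤ x) (h2 : m = n - 1 ∨ x ≤ trainPt n D (m + 1) + δ) :
    s x = (trainPt n D (m + 1) - x) / t := by
  rcases eq_or_ne m 0 with rfl | hm0
  · exact hs.1 x (h2.resolve_left (by omega))
  have h1' := h1.resolve_left hm0
  rcases eq_or_ne m (n - 1) with rfl | hmn
  · have : n - 1 + 1 = n := by omega
    rw [this] at h1' ⊢
    exact hs.2.1 x h1'
  · exact hs.2.2.1 (m + 1) (by omega) (by omega) x ⟨h1', h2.resolve_left hmn⟩

theorem IsShat.eq_ramp (hs : IsShat n D t δ s) {m : ℕ} (hm : m < n - 1) {x : ℝ}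
    (h1 : trainPt n D (m + 1) + δ ≤ x) (h2 : x ≤ trainPt n D (m + 1 + 1) - δ) :
    s x = δ / (D / ((n : ℝ) - 1) - δ) * (x - (trainPt n D (m + 1) + D / ((n : ℝ) - 1))) / t :=
  hs.2.2.2 (m + 1) (by omega) (by omega) x ⟨h1, h2⟩

/-- Every point lies in a plateau around a training point or on a ramp between two of them. -/
theorem plateau_or_ramp (n : ℕ) (D : ℝ) {δ : ℝ} (hδ : 0 ≤ δ) (x : ℝ) :
    (∃ m ≤ n - 1, (m = 0 ∨ trainPt n D (m + 1) - δ ≤ x) ∧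
      (m = n - 1 ∨ x ≤ trainPt n D (m + 1) + δ)) ∨
    (∃ m < n - 1, trainPt n D (m + 1) + δ ≤ x ∧ x ≤ trainPt n D (m + 1 + 1) - δ) := by
  have key : ∀ M ≤ n - 1, x ≤ trainPt n D (M + 1) + δ →
      (∃ m ≤ n - 1, (m = 0 ∨ trainPt n D (m + 1) - δ ≤ x) ∧
        (m = n - 1 ∨ x ≤ trainPt n D (m + 1) + δ)) ∨
      (∃ m < n - 1, trainPt n D (m + 1) + δ ≤ x ∧ x ≤ trainPt n D (m + 1 + 1) - δ) := by
    intro M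
    induction M with
    | zero => exact fun h hx => Or.inl ⟨0, h, Or.inl rfl, Or.inr hx⟩
    | succ M ih =>
      intro h hx
      rcases le_total (trainPt n D (M + 1 + 1) - δ) x with h1 | h1
      · exact Or.inl ⟨M + 1, h, Or.inr h1, Or.inr hx⟩
      · rcases le_total (trainPt n D (M + 1) + δ) x with h2 | h2
        · exact Or.inr ⟨M, by omega, h2, h1⟩
        · exact ih (by omega) h2
  rcases le_total x (trainPt n D (n - 1 + 1) + δ) with h | h
  · exact key _ le_rfl h
  · rcases le_total (trainPt n D (n - 1 + 1) - δ) x with h2 | h2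
    · exact Or.inl ⟨n - 1, le_rfl, Or.inr h2, Or.inl rfl⟩
    · exact key _ le_rfl (by linarith)

/-- Closed form of the smoothed piecewise-linear score. -/
theorem IsShat.eq_sum (hs : IsShat n D t δ s) (hn : 2 ≤ n) (hD : 0 < D) (ht : 0 < t)
    (hδ : δ ∈ Ioo 0 (D / ((n : ℝ) - 1))) (x : ℝ) :
    s x = (trainPt n D 1 - x) / t + D / ((n : ℝ) - 1) / (t * (D / ((n : ℝ) - 1) - δ)) *
      ∑ j ∈ Finset.range (n - 1), (max (x - (trainPt n D (j + 1) + δ)) 0 -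
        max (x - (trainPt n D (j + 1 + 1) - δ)) 0) := by
  have hn3 : (2 : ℝ) ≤ n := by exact_mod_cast hn
  have hΔ0 : 0 < D / ((n : ℝ) - 1) := div_pos hD (by linarith)
  simp only [trainPt_succ]
  obtain ⟨hδ0, hδ1⟩ := hδ
  have hsub : D / ((n : ℝ) - 1) - δ ≠ 0 := by linarith
  have hcard : ∀ m ≤ n - 1, (Finset.filter (fun j => j < m) (Finset.range (n - 1))).card = m := by
    intro m hm
    rw [show Finset.filter (fun j => j < m) (Finset.range (n - 1)) = Finset.range m by
      ext j; simp; omega, Finset.card_range]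
  rcases plateau_or_ramp n D hδ0.le x with ⟨m, hm, h1, h2⟩ | ⟨m, hm, h1, h2⟩
  · rw [hs.eq_plateau hn hm h1 h2]
    simp only [trainPt_succ] at h1 h2 ⊢
    set Δ := D / ((n : ℝ) - 1)
    have hterm : ∀ j ∈ Finset.range (n - 1), max (x - (2 * (j * Δ) - D + δ)) 0 -
        max (x - (2 * (((j + 1 : ℕ) : ℝ) * Δ) - D - δ)) 0 =
        if j < m then 2 * (Δ - δ) else 0 := by
      intro j hj
      rw [Finset.mem_range] at hj
      push_cast
      split_ifs with hjm
      · have := mul_step_le hjm hΔ0.le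
        have h1' := h1.resolve_left (by omega)
        rw [max_eq_left (by linarith), max_eq_left (by linarith)]
        ring
      · have := mul_le_of_le (not_lt.1 hjm) hΔ0.le
        have h2' := h2.resolve_left (by omega)
        rw [max_eq_right (by linarith), max_eq_right (by linarith), sub_zero]
    rw [Finset.sum_congr rfl hterm, ← Finset.sum_filter, Finset.sum_const, hcard m hm,
      nsmul_eq_mul]
    field_simp
    ring
  · rw [hs.eq_ramp hm h1 h2]
    simp only [trainPt_succ] at h1 h2 ⊢
    push_cast at h2
    set Δ := D / ((n : ℝ) - 1)
    have hterm : ∀ j ∈ Finset.range (n - 1), max (x - (2 * (j * Δ) - D + δ)) 0 -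
        max (x - (2 * (((j + 1 : ℕ) : ℝ) * Δ) - D - δ)) 0 =
        (if j < m then 2 * (Δ - δ) else 0) +
          if j = m then x - (2 * (m * Δ) - D + δ) else 0 := by
      intro j hj
      rw [Finset.mem_range] at hj
      push_cast
      rcases lt_trichotomy j m with hjm | rfl | hjm
      · have := mul_step_le hjm hΔ0.le
        rw [max_eq_left (by linarith), max_eq_left (by linarith), if_pos hjm, if_neg (by omega)]
        ring
      · rw [max_eq_left (by linarith), max_eq_right (by linarith), if_neg (by omega), if_pos rfl]
        ring
      · have := mul_step_le hjm hΔ0.le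
        rw [max_eq_right (by linarith), max_eq_right (by linarith), if_neg (by omega),
          if_neg (by omega)]
        ring
    rw [Finset.sum_congr rfl hterm, Finset.sum_add_distrib, ← Finset.sum_filter, Finset.sum_const,
      hcard m hm.le, nsmul_eq_mul, Finset.sum_ite_eq' _ m, if_pos (Finset.mem_range.2 hm)]
    field_simp
    ring

/-- Deviation of the smoothed score from the score of a single Gaussian. -/
theorem IsShat.sq_sub_le (hs : IsShat n D t δ s) (hn : 2 ≤ n) (hD : 0 < D) (ht : 0 < t)
    (hδ : δ ∈ Ioo 0 (D / ((n : ℝ) - 1))) {m : ℕ} (hm : m ≤ n - 1) (x : ℝ) :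
    (s x - (trainPt n D (m + 1) - x) / t) ^ 2 ≤
      (D / ((n : ℝ) - 1) / (t * (D / ((n : ℝ) - 1) - δ))) ^ 2 *
      ((if m < n - 1 then max (x - trainPt n D (m + 1) - δ) 0 ^ 2 else 0) +
        if 0 < m then max (-(x - trainPt n D (m + 1)) - δ) 0 ^ 2 else 0) := by
  have hn3 : (2 : ℝ) ≤ n := by exact_mod_cast hn
  have hΔ0 : 0 < D / ((n : ℝ) - 1) := div_pos hD (by linarith)
  obtain ⟨hδ0, hδ1⟩ := hδ
  have hR : ∀ a b : ℝ, 0 ≤ (if m < n - 1 then max a 0 ^ 2 else 0) +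
      if 0 < m then max b 0 ^ 2 else 0 := fun a b => by split_ifs <;> positivity
  set Δ := D / ((n : ℝ) - 1) with hΔ
  have hsub : 0 < Δ - δ := by linarith
  have up : ∀ v, m < n - 1 → 0 ≤ v → v * (Δ - δ) ≤ Δ * (x - trainPt n D (m + 1) - δ) →
      (v / t) ^ 2 ≤ (Δ / (t * (Δ - δ))) ^ 2 *
      ((if m < n - 1 then max (x - trainPt n D (m + 1) - δ) 0 ^ 2 else 0) +
        if 0 < m then max (-(x - trainPt n D (m + 1)) - δ) 0 ^ 2 else 0) := by
    intro v hmn hv h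
    rw [if_pos hmn]
    have h1 : v / t ≤ Δ / (t * (Δ - δ)) * max (x - trainPt n D (m + 1) - δ) 0 := by
      rw [div_mul_eq_mul_div, div_le_div_iff₀ ht (by positivity)]
      have := mul_le_mul_of_nonneg_left (le_max_left (x - trainPt n D (m + 1) - δ) 0) hΔ0.le
      have := mul_le_mul_of_nonneg_left (h.trans this) ht.le
      linarith
    have h2 := pow_le_pow_left₀ (by positivity) h1 2
    rw [mul_pow] at h2
    refine h2.trans (mul_le_mul_of_nonneg_left ?_ (sq_nonneg _))
    exact le_add_of_nonneg_right (by split_ifs <;> positivity)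
  have dn : ∀ v, 0 < m → 0 ≤ v → v * (Δ - δ) ≤ Δ * (-(x - trainPt n D (m + 1)) - δ) →
      (-v / t) ^ 2 ≤ (Δ / (t * (Δ - δ))) ^ 2 *
      ((if m < n - 1 then max (x - trainPt n D (m + 1) - δ) 0 ^ 2 else 0) +
        if 0 < m then max (-(x - trainPt n D (m + 1)) - δ) 0 ^ 2 else 0) := by
    intro v hm0 hv h
    rw [if_pos hm0, neg_div, neg_sq]
    have h1 : v / t ≤ Δ / (t * (Δ - δ)) * max (-(x - trainPt n D (m + 1)) - δ) 0 := by
      rw [div_mul_eq_mul_div, div_le_div_iff₀ ht (by positivity)]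
      have := mul_le_mul_of_nonneg_left (le_max_left (-(x - trainPt n D (m + 1)) - δ) 0) hΔ0.le
      have := mul_le_mul_of_nonneg_left (h.trans this) ht.le
      linarith
    have h2 := pow_le_pow_left₀ (by positivity) h1 2
    rw [mul_pow] at h2
    refine h2.trans (mul_le_mul_of_nonneg_left ?_ (sq_nonneg _))
    exact le_add_of_nonneg_left (by split_ifs <;> positivity)
  rcases plateau_or_ramp n D hδ0.le x with ⟨j, hj, h1, h2⟩ | ⟨j, hj, h1, h2⟩
  · rw [hs.eq_plateau hn hj h1 h2, ← sub_div]
    rcases lt_trichotomy j m with hjm | rfl | hjm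
    · have hst := mul_step_le hjm hΔ0.le
      have hst1 := mul_step_le hjm hδ0.le
      have h2' := h2.resolve_left (by omega)
      have := dn (-(trainPt n D (j + 1) - x - (trainPt n D (m + 1) - x))) (by omega)
      rw [neg_neg] at this
      simp only [trainPt_succ, ← hΔ] at this h2' ⊢
      exact this (by linarith) (by nlinarith)
    · rw [sub_self, zero_div, zero_pow two_ne_zero]
      exact mul_nonneg (sq_nonneg _) (hR _ _)
    · have hst := mul_step_le hjm hΔ0.le
      have hst1 := mul_step_le hjm hδ0.le
      have h1' := h1.resolve_left (by omega)
      have := up (trainPt n D (j + 1) - x - (trainPt n D (m + 1) - x)) (by omega)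
      simp only [trainPt_succ, ← hΔ] at this h1' ⊢
      exact this (by linarith) (by nlinarith)
  · rw [hs.eq_ramp hj h1 h2, ← sub_div, ← hΔ]
    rcases lt_or_ge j m with hjm | hjm
    · have hst := mul_step_le hjm hΔ0.le
      have := dn (-(δ / (Δ - δ) * (x - (trainPt n D (j + 1) + Δ)) - (trainPt n D (m + 1) - x)))
        (by omega)
      rw [neg_neg] at this
      simp only [trainPt_succ, ← hΔ] at this h1 h2 ⊢
      push_cast at h2
      have key : -(δ / (Δ - δ) * (x - (2 * (j * Δ) - D + Δ)) - (2 * (m * Δ) - D - x)) =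
        (-(δ * (x - (2 * (j * Δ) - D + Δ))) + (2 * (m * Δ) - D - x) * (Δ - δ)) / (Δ - δ) := by
        field_simp
        ring
      refine this ?_ ?_
      · rw [key]
        refine div_nonneg ?_ hsub.le
        nlinarith
      · rw [key, div_mul_cancel₀ _ hsub.ne']
        nlinarith
    · have hst := mul_le_of_le hjm hΔ0.le
      have := up (δ / (Δ - δ) * (x - (trainPt n D (j + 1) + Δ)) - (trainPt n D (m + 1) - x))
        (by omega)
      simp only [trainPt_succ, ← hΔ] at this h1 h2 ⊢
      push_cast at h2
      have key : δ / (Δ - δ) * (x - (2 * (j * Δ) - D + Δ)) - (2 * (m * Δ) - D - x) =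
        (δ * (x - (2 * (j * Δ) - D + Δ)) - (2 * (m * Δ) - D - x) * (Δ - δ)) / (Δ - δ) := by
        field_simp
      refine this ?_ ?_
      · rw [key]
        refine div_nonneg ?_ hsub.le
        nlinarith
      · rw [key, div_mul_cancel₀ _ hsub.ne']
        nlinarith

end Shat

theorem integrable_gaussD_mul_max_sq {κ : ℝ} (hκ : 0 < κ) :
    Integrable fun u : ℝ => gaussD u 1 * max (u - κ) 0 ^ 2 := by
  refine integrable_sq_mul_gaussD.mono' (by fun_prop) (ae_of_all _ fun u => ?_)
  have hg := gaussD_pos u one_pos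
  rw [Real.norm_of_nonneg (by positivity), mul_comm]
  refine mul_le_mul_of_nonneg_right ?_ hg.le
  rcases le_total (u - κ) 0 with h | h
  · rw [max_eq_right h]; nlinarith
  · rw [max_eq_left h]; nlinarith

theorem integral_gaussD_mul_max_sq (κ : ℝ) :
    ∫ u : ℝ, gaussD u 1 * max (u - κ) 0 ^ 2 = Fgauss κ / 2 := by
  unfold Fgauss
  rw [mul_div_cancel_left₀ _ two_ne_zero, ← integral_indicator measurableSet_Ioi]
  refine integral_congr_ae (ae_of_all _ fun u => ?_)
  by_cases h : κ < u
  · simp only [indicator_of_mem (mem_Ioi.2 h)]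
    rw [max_eq_left (by linarith)]
    ring
  · simp only [indicator_of_notMem (show u ∉ Ioi κ from h)]
    rw [max_eq_right (by linarith)]
    ring

section Loss

variable {t κ : ℝ}

theorem gaussD_sqrt_mul_max_sq (ht : 0 < t) (κ u : ℝ) :
    gaussD (√t * u) (√t) * max (√t * u - κ * √t) 0 ^ 2 =
      √t * (gaussD u 1 * max (u - κ) 0 ^ 2) := by
  have h : 0 < √t := Real.sqrt_pos.2 ht
  have h1 : max (√t * u - κ * √t) 0 = √t * max (u - κ) 0 := by
    rw [mul_max_of_nonneg _ _ h.le, mul_zero]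
    congr 1
    ring
  rw [gaussD_sqrt_mul ht, h1]
  field_simp

theorem integrable_gaussD_sqrt_mul_max_sq (ht : 0 < t) (hκ : 0 < κ) :
    Integrable fun h : ℝ => gaussD h (√t) * max (h - κ * √t) 0 ^ 2 := by
  refine (integrable_comp_mul_left_iff _ (Real.sqrt_pos.2 ht).ne').1 ?_
  simp_rw [gaussD_sqrt_mul_max_sq ht]
  exact (integrable_gaussD_mul_max_sq hκ).const_mul _

theorem integral_gaussD_sqrt_mul_max_sq (ht : 0 < t) (κ : ℝ) :
    ∫ h : ℝ, gaussD h (√t) * max (h - κ * √t) 0 ^ 2 = t * (Fgauss κ / 2) := by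
  have h : 0 < √t := Real.sqrt_pos.2 ht
  have := Measure.integral_comp_mul_left
    (fun h : ℝ => gaussD h (√t) * max (h - κ * √t) 0 ^ 2) (√t)
  simp_rw [gaussD_sqrt_mul_max_sq ht] at this
  rw [integral_const_mul, integral_gaussD_mul_max_sq, abs_of_pos (inv_pos.2 h), smul_eq_mul,
    eq_comm, inv_mul_eq_iff_eq_mul₀ h.ne', ← mul_assoc, Real.mul_self_sqrt ht.le] at this
  exact this

theorem integral_gaussD_mul_max_sq_sub (ht : 0 < t) (hκ : 0 < κ) (y : ℝ) :
    Integrable (fun x : ℝ => gaussD (x - y) (√t) * max (x - y - κ * √t) 0 ^ 2) ∧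
      ∫ x : ℝ, gaussD (x - y) (√t) * max (x - y - κ * √t) 0 ^ 2 = t * (Fgauss κ / 2) := by
  refine ⟨(integrable_gaussD_sqrt_mul_max_sq ht hκ).comp_sub_right y, ?_⟩
  rw [← integral_gaussD_sqrt_mul_max_sq ht κ]
  exact integral_sub_right_eq_self (fun h : ℝ => gaussD h (√t) * max (h - κ * √t) 0 ^ 2) y

theorem integral_gaussD_mul_max_sq_neg (ht : 0 < t) (hκ : 0 < κ) (y : ℝ) :
    Integrable (fun x : ℝ => gaussD (x - y) (√t) * max (-(x - y) - κ * √t) 0 ^ 2) ∧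
      ∫ x : ℝ, gaussD (x - y) (√t) * max (-(x - y) - κ * √t) 0 ^ 2 = t * (Fgauss κ / 2) := by
  have h := integral_gaussD_mul_max_sq_sub ht hκ (-y)
  have e : ∀ x : ℝ, gaussD (x - y) (√t) * max (-(x - y) - κ * √t) 0 ^ 2 =
      (fun x : ℝ => gaussD (x - -y) (√t) * max (x - -y - κ * √t) 0 ^ 2) (-x) := fun x => by
    simp only
    rw [show -x - -y = -(x - y) by ring, gaussD_neg]
  simp_rw [e]
  exact ⟨h.1.comp_neg, (integral_neg_eq_self _ volume).trans h.2⟩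

/-- Score matching loss of the smoothed piecewise-linear score. -/
theorem IsShat.loss_le {n : ℕ} {D : ℝ} {s : ℝ → ℝ} (hs : IsShat n D t (κ * √t) s)
    (hn : 2 ≤ n) (hD : 0 < D) (ht : 0 < t) (hκ : 0 < κ)
    (hδ : κ * √t ∈ Ioo 0 (D / ((n : ℝ) - 1))) :
    t * ∫ x, (s x - scoreEmp n D t x) ^ 2 * pEmp n D t x ≤
      ((n : ℝ) - 1) / n * (D / ((n : ℝ) - 1) / (D / ((n : ℝ) - 1) - κ * √t)) ^ 2 * Fgauss κ := by
  set C := (D / ((n : ℝ) - 1) / (t * (D / ((n : ℝ) - 1) - κ * √t))) ^ 2 with hC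
  let G : ℕ → ℝ → ℝ := fun k x => gaussD (x - trainPt n D k) (√t) *
    ((if k < n then max (x - trainPt n D k - κ * √t) 0 ^ 2 else 0) +
      if 1 < k then max (-(x - trainPt n D k) - κ * √t) 0 ^ 2 else 0)
  have hG : ∀ k, Integrable (G k) ∧ ∫ x, G k x =
      (if k < n then t * (Fgauss κ / 2) else 0) + if 1 < k then t * (Fgauss κ / 2) else 0 := by
    intro k
    have h1 := integral_gaussD_mul_max_sq_sub ht hκ (trainPt n D k)
    have h2 := integral_gaussD_mul_max_sq_neg ht hκ (trainPt n D k)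
    simp only [G, mul_add, mul_ite, mul_zero]
    by_cases hk : k < n <;> by_cases hk' : 1 < k <;> simp only [hk, hk', if_true, if_false]
    · exact ⟨h1.1.add h2.1, by rw [integral_add h1.1 h2.1, h1.2, h2.2]⟩
    · simpa using h1
    · simpa using h2
    · simp
  have hle : ∀ x, (s x - scoreEmp n D t x) ^ 2 * pEmp n D t x ≤
      1 / (n : ℝ) * C * ∑ k ∈ Finset.Icc 1 n, G k x := by
    intro x
    refine (sq_sub_scoreEmp_mul_pEmp_le hn ht x (s x)).trans ?_
    rw [mul_assoc]
    refine mul_le_mul_of_nonneg_left ?_ (by positivity)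
    rw [Finset.mul_sum]
    refine Finset.sum_le_sum fun k hk => ?_
    obtain ⟨hk1, hk2⟩ := Finset.mem_Icc.1 hk
    obtain ⟨m, rfl⟩ : ∃ m, k = m + 1 := ⟨k - 1, by omega⟩
    have := hs.sq_sub_le hn hD ht hδ (m := m) (by omega) x
    refine (mul_le_mul_of_nonneg_left this (gaussD_pos _ (Real.sqrt_pos.2 ht)).le).trans_eq ?_
    have e1 : m < n - 1 ↔ m + 1 < n := by omega
    have e2 : 0 < m ↔ 1 < m + 1 := by omega
    simp only [G, e1, e2, ← hC]
    ring
  have hint : ∫ x, (s x - scoreEmp n D t x) ^ 2 * pEmp n D t x ≤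
      ∫ x, 1 / (n : ℝ) * C * ∑ k ∈ Finset.Icc 1 n, G k x :=
    integral_mono_of_nonneg
      (ae_of_all _ fun x => mul_nonneg (sq_nonneg _) (pEmp_pos hn ht x).le)
      ((integrable_finsetSum _ fun k _ => (hG k).1).const_mul _) (ae_of_all _ hle)
  have hcard1 : (Finset.filter (fun k => k < n) (Finset.Icc 1 n)).card = n - 1 := by
    rw [show Finset.filter (fun k => k < n) (Finset.Icc 1 n) = Finset.Icc 1 (n - 1) by
      ext j; simp; omega, Nat.card_Icc]
    omega
  have hcard2 : (Finset.filter (fun k => 1 < k) (Finset.Icc 1 n)).card = n - 1 := by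
    rw [show Finset.filter (fun k => 1 < k) (Finset.Icc 1 n) = Finset.Icc 2 n by
      ext j; simp; omega, Nat.card_Icc]
    omega
  rw [integral_const_mul, integral_finsetSum _ (fun k _ => (hG k).1),
    Finset.sum_congr rfl (fun k _ => (hG k).2), Finset.sum_add_distrib, ← Finset.sum_filter,
    ← Finset.sum_filter, Finset.sum_const, Finset.sum_const, hcard1, hcard2, nsmul_eq_mul,
    Nat.cast_sub (by omega), Nat.cast_one] at hint
  refine (mul_le_mul_of_nonneg_left hint ht.le).trans_eq ?_
  have hδ' : D / ((n : ℝ) - 1) - κ * √t ≠ 0 := (sub_pos.2 hδ.2).ne'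
  rw [hC]
  generalize D / ((n : ℝ) - 1) = Δ at *
  field_simp
  ring

end Loss

theorem hasDerivWithinAt_max_sub (a x : ℝ) :
    HasDerivWithinAt (fun y => max (y - a) 0) (if a < x then 1 else 0) (Iic x) x := by
  split_ifs with h
  · refine (((hasDerivAt_id x).sub_const a).congr_of_eventuallyEq ?_).hasDerivWithinAt
    filter_upwards [eventually_gt_nhds h] with y hy
    exact max_eq_left (sub_nonneg.2 hy.le)
  · refine (hasDerivWithinAt_const x (Iic x) (0 : ℝ)).congr (fun y hy => ?_) ?_
    · exact max_eq_right (sub_nonpos.2 (le_trans hy (not_lt.1 h)))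
    · exact max_eq_right (sub_nonpos.2 (not_lt.1 h))

/-- Left derivative of the smoothed piecewise-linear score. -/
noncomputable def shatSlope (n : ℕ) (D t δ x : ℝ) : ℝ :=
  -1 / t + D / ((n : ℝ) - 1) / (t * (D / ((n : ℝ) - 1) - δ)) *
    ∑ j ∈ Finset.range (n - 1), ((if trainPt n D (j + 1) + δ < x then 1 else 0) -
      if trainPt n D (j + 1 + 1) - δ < x then 1 else 0)

/-- A monotone function dominating the increments of `shatSlope`. -/
noncomputable def shatTotalSlope (n : ℕ) (D t δ x : ℝ) : ℝ :=
  D / ((n : ℝ) - 1) / (t * (D / ((n : ℝ) - 1) - δ)) *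
    ∑ j ∈ Finset.range (n - 1), ((if trainPt n D (j + 1) + δ < x then 1 else 0) +
      if trainPt n D (j + 1 + 1) - δ < x then 1 else 0)

section Variation

variable {n : ℕ} {D t δ : ℝ} {s : ℝ → ℝ}

theorem IsShat.deriv_eq_shatSlope (hs : IsShat n D t δ s) (hn : 2 ≤ n) (hD : 0 < D) (ht : 0 < t)
    (hδ : δ ∈ Ioo 0 (D / ((n : ℝ) - 1))) {x : ℝ} (hx : DifferentiableAt ℝ s x) :
    deriv s x = shatSlope n D t δ x := by
  have h1 : HasDerivWithinAt s (shatSlope n D t δ x) (Iic x) x := by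
    rw [show s = _ from funext (hs.eq_sum hn hD ht hδ)]
    refine HasDerivWithinAt.add ?_ (HasDerivWithinAt.const_mul _
      (HasDerivWithinAt.fun_sum fun j _ =>
        (hasDerivWithinAt_max_sub _ x).sub (hasDerivWithinAt_max_sub _ x)))
    exact (((hasDerivAt_id x).const_sub _).div_const t).hasDerivWithinAt
  exact (uniqueDiffWithinAt_Iic x).eq_deriv _ hx.hasDerivAt.hasDerivWithinAt h1

theorem indicator_lt_mono (a : ℝ) {x y : ℝ} (hxy : x ≤ y) :
    (if a < x then (1 : ℝ) else 0) ≤ if a < y then 1 else 0 := by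
  split_ifs with h1 h2
  · exact le_rfl
  · exact absurd (h1.trans_le hxy) h2
  · exact zero_le_one
  · exact le_rfl

theorem abs_shatSlope_sub_le (hn : 2 ≤ n) (hD : 0 < D) (ht : 0 < t)
    (hδ : δ ∈ Ioo 0 (D / ((n : ℝ) - 1))) {x y : ℝ} (hxy : x ≤ y) :
    |shatSlope n D t δ y - shatSlope n D t δ x| ≤
      shatTotalSlope n D t δ y - shatTotalSlope n D t δ x := by
  have hn3 : (2 : ℝ) ≤ n := by exact_mod_cast hn
  have hΔ0 : 0 < D / ((n : ℝ) - 1) := div_pos hD (by linarith)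
  have hsub : 0 < D / ((n : ℝ) - 1) - δ := sub_pos.2 hδ.2
  unfold shatSlope shatTotalSlope
  rw [add_sub_add_left_eq_sub, ← mul_sub, ← mul_sub, ← Finset.sum_sub_distrib,
    ← Finset.sum_sub_distrib, abs_mul, abs_of_pos (by positivity)]
  refine mul_le_mul_of_nonneg_left ((Finset.abs_sum_le_sum_abs _ _).trans
    (Finset.sum_le_sum fun j _ => ?_)) (by positivity)
  have h1 := indicator_lt_mono (trainPt n D (j + 1) + δ) hxy
  have h2 := indicator_lt_mono (trainPt n D (j + 1 + 1) - δ) hxy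
  rw [abs_le]
  constructor <;> linarith

theorem shatTotalSlope_sub_le (hn : 2 ≤ n) (hD : 0 < D) (ht : 0 < t)
    (hδ : δ ∈ Ioo 0 (D / ((n : ℝ) - 1))) (x y : ℝ) :
    shatTotalSlope n D t δ y - shatTotalSlope n D t δ x ≤
      2 * ((n : ℝ) - 1) * (D / ((n : ℝ) - 1)) / (t * (D / ((n : ℝ) - 1) - δ)) := by
  have hn3 : (2 : ℝ) ≤ n := by exact_mod_cast hn
  have hΔ0 : 0 < D / ((n : ℝ) - 1) := div_pos hD (by linarith)
  have hsub : 0 < D / ((n : ℝ) - 1) - δ := sub_pos.2 hδ.2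
  have h1 : ∀ x, 0 ≤ ∑ j ∈ Finset.range (n - 1),
      ((if trainPt n D (j + 1) + δ < x then (1 : ℝ) else 0) +
      if trainPt n D (j + 1 + 1) - δ < x then 1 else 0) := fun x =>
    Finset.sum_nonneg fun j _ => by split_ifs <;> norm_num
  have h2 : ∑ j ∈ Finset.range (n - 1),
      ((if trainPt n D (j + 1) + δ < y then (1 : ℝ) else 0) +
      if trainPt n D (j + 1 + 1) - δ < y then 1 else 0) ≤ 2 * ((n : ℝ) - 1) := by
    refine (Finset.sum_le_card_nsmul _ _ 2 fun j _ => ?_).trans_eq ?_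
    · split_ifs <;> norm_num
    · rw [Finset.card_range, nsmul_eq_mul, Nat.cast_sub (by omega), Nat.cast_one, mul_comm]
  unfold shatTotalSlope
  rw [← mul_sub, mul_div_assoc, mul_comm]
  exact mul_le_mul_of_nonneg_right (by linarith [h1 x]) (by positivity)

theorem shatTotalSlope_mono (hn : 2 ≤ n) (hD : 0 < D) (ht : 0 < t)
    (hδ : δ ∈ Ioo 0 (D / ((n : ℝ) - 1))) : Monotone (shatTotalSlope n D t δ) :=
  fun _ _ hxy => sub_nonneg.1 ((abs_nonneg _).trans (abs_shatSlope_sub_le hn hD ht hδ hxy))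

theorem IsShat.hasDerivAt_trainPt (hs : IsShat n D t δ s) (hn : 2 ≤ n) (hδ : 0 < δ) {m : ℕ}
    (hm : m ≤ n - 1) : HasDerivAt s (-1 / t) (trainPt n D (m + 1)) := by
  refine HasDerivAt.congr_of_eventuallyEq
    (((hasDerivAt_id _).const_sub (trainPt n D (m + 1))).div_const t) ?_
  filter_upwards [eventually_gt_nhds (sub_lt_self (trainPt n D (m + 1)) hδ),
    eventually_lt_nhds (lt_add_of_pos_right (trainPt n D (m + 1)) hδ)] with x h1 h2
  exact hs.eq_plateau hn hm (Or.inr h1.le) (Or.inr h2.le)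

theorem IsShat.hasDerivAt_midpoint (hs : IsShat n D t δ s)
    (hδ : δ < D / ((n : ℝ) - 1)) {m : ℕ} (hm : m < n - 1) :
    HasDerivAt s (δ / (D / ((n : ℝ) - 1) - δ) / t)
      (trainPt n D (m + 1) + D / ((n : ℝ) - 1)) := by
  have h0 : HasDerivAt (fun x => δ / (D / ((n : ℝ) - 1) - δ) *
      (x - (trainPt n D (m + 1) + D / ((n : ℝ) - 1))) / t) (δ / (D / ((n : ℝ) - 1) - δ) / t)
      (trainPt n D (m + 1) + D / ((n : ℝ) - 1)) :=
    ((((hasDerivAt_id _).sub_const _).const_mul _).div_const t).congr_deriv (by rw [mul_one])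
  refine h0.congr_of_eventuallyEq ?_
  have h1 : trainPt n D (m + 1) + δ < trainPt n D (m + 1) + D / ((n : ℝ) - 1) := by linarith
  have h2 : trainPt n D (m + 1) + D / ((n : ℝ) - 1) < trainPt n D (m + 1 + 1) - δ := by
    simp only [trainPt_succ]
    push_cast
    linarith
  filter_upwards [eventually_gt_nhds h1, eventually_lt_nhds h2] with x h1 h2
  exact hs.eq_ramp hm h1.le h2.le

end Variation

section Lines

variable {d : ℕ}

local notation "𝔼" => EuclideanSpace ℝ (Fin (d + 1))

theorem deriv_euclidean_apply {g : ℝ → 𝔼} {x : ℝ} (hg : DifferentiableAt ℝ g x)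
    (i : Fin (d + 1)) : HasDerivAt (fun y => g y i) (deriv g x i) x :=
  (EuclideanSpace.proj (𝕜 := ℝ) i).hasFDerivAt.comp_hasDerivAt x hg.hasDerivAt

/-- The oscillations of the derivative of a component along a line bound the non-smoothness
measure from below. -/
theorem ofReal_zigzag_le_RnsD (f : 𝔼 → 𝔼) {w : 𝔼} (hw : ‖w‖ = 1) (b : 𝔼) (i : Fin (d + 1))
    (N : ℕ) (p q : ℕ → ℝ)
    (hp : ∀ k ≤ N, DifferentiableAt ℝ (fun x : ℝ => f (x • w + b)) (p k))
    (hq : ∀ k < N, DifferentiableAt ℝ (fun x : ℝ => f (x • w + b)) (q k))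
    (hpq : ∀ k < N, p k ≤ q k) (hqp : ∀ k < N, q k ≤ p (k + 1)) :
    ENNReal.ofReal (∑ k ∈ Finset.range N,
      ((deriv (fun x : ℝ => f (x • w + b) i) (q k) - deriv (fun x : ℝ => f (x • w + b) i) (p k)) +
      (deriv (fun x : ℝ => f (x • w + b) i) (q k) -
        deriv (fun x : ℝ => f (x • w + b) i) (p (k + 1))))) ≤ RnsD d f := by
  set g : ℝ → 𝔼 := fun x => f (x • w + b) with hg
  have h1 := ofReal_zigzag_le_eVariationOn (g := deriv fun x => g x i)
    (s := {x | DifferentiableAt ℝ g x}) N p q hp hq hpq hqp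
  refine h1.trans ?_
  have h2 : eVariationOn (deriv fun x => g x i) {x | DifferentiableAt ℝ g x} ≤
      eVariationOn (deriv g) {x | DifferentiableAt ℝ g x} := by
    have h3 : EqOn (deriv fun x => g x i) ((fun v : 𝔼 => v i) ∘ deriv g)
        {x | DifferentiableAt ℝ g x} := fun x hx => (deriv_euclidean_apply hx i).deriv
    rw [eVariationOn.congr h3]
    have h4 : LipschitzWith 1 (fun v : 𝔼 => v i) := LipschitzWith.of_dist_le_mul fun u v => by
      rw [NNReal.coe_one, one_mul, dist_eq_norm, dist_eq_norm]
      exact PiLp.norm_apply_le (u - v) i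
    have := (h4.lipschitzOnWith (s := univ)).comp_eVariationOn_le (g := deriv g)
      (s := {x | DifferentiableAt ℝ g x}) (mapsTo_univ _ _)
    simpa using this
  refine h2.trans ?_
  exact le_iSup_of_le w (le_iSup_of_le hw (le_iSup_of_le b le_rfl))

/-- The non-smoothness measure of the multi-dimensional smoothed score. -/
theorem IsShat.RnsD_eq {n : ℕ} {D t δ : ℝ} {s : ℝ → ℝ} (hs : IsShat n D t δ s) (hn : 2 ≤ n)
    (hD : 0 < D) (ht : 0 < t) (hδ : δ ∈ Ioo 0 (D / ((n : ℝ) - 1))) {svec : 𝔼 → 𝔼}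
    (hsv : ∀ x i, svec x i = if i = 0 then s (x 0) else -(x i) / t) :
    RnsD d svec = ENNReal.ofReal (2 * ((n : ℝ) - 1) * (D / ((n : ℝ) - 1)) /
      (t * (D / ((n : ℝ) - 1) - δ))) := by
  refine le_antisymm ?_ ?_
  · refine iSup_le fun w => iSup_le fun hw => iSup_le fun b => ?_
    have hw0 : |w 0| ≤ 1 := hw ▸ PiLp.norm_apply_le w 0
    set g : ℝ → 𝔼 := fun x => svec (x • w + b) with hg
    have hlin : ∀ i x, HasDerivAt (fun x : ℝ => x * w i + b i) (w i) x := fun i x =>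
      (((hasDerivAt_id x).mul_const (w i)).add_const (b i)).congr_deriv (one_mul _)
    have hd0 : ∀ x, DifferentiableAt ℝ g x →
        deriv g x 0 = w 0 * shatSlope n D t δ (x * w 0 + b 0) := by
      intro x hx
      have h1 := deriv_euclidean_apply hx 0
      have h2 : (fun y => g y 0) = fun y => s (y * w 0 + b 0) := by
        funext y; simp [hg, hsv]
      rw [h2] at h1
      by_cases h0 : w 0 = 0
      · simp only [h0, mul_zero, zero_add, zero_mul] at h1 ⊢
        exact h1.unique (hasDerivAt_const x _)
      · have h3 : DifferentiableAt ℝ s (x * w 0 + b 0) := by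
          have e : s = (fun y => s (y * w 0 + b 0)) ∘ fun v => (v - b 0) / w 0 := by
            funext v
            simp only [Function.comp]
            congr 1
            field_simp
            ring
          rw [e]
          refine DifferentiableAt.comp _ ?_ (by fun_prop)
          have e' : (x * w 0 + b 0 - b 0) / w 0 = x := by field_simp; ring
          rw [e']
          exact h1.differentiableAt
        have h4 := h3.hasDerivAt
        rw [hs.deriv_eq_shatSlope hn hD ht hδ h3] at h4
        rw [mul_comm]
        exact h1.unique (h4.comp x (hlin 0 x))
    have hdi : ∀ i ≠ 0, ∀ x, DifferentiableAt ℝ g x → deriv g x i = -w i / t := by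
      intro i hi x hx
      refine (deriv_euclidean_apply hx i).unique ?_
      have h2 : (fun y => g y i) = fun y => -(y * w i + b i) / t := by
        funext y; simp [hg, hsv, hi]
      rw [h2]
      exact (hlin i x).neg.div_const t
    refine eVariationOn_le_of_dominated
      (T := fun x => w 0 * shatTotalSlope n D t δ (x * w 0 + b 0)) ?_ ?_ ?_
    · intro x y hxy
      rcases le_total 0 (w 0) with h | h
      · exact mul_le_mul_of_nonneg_left (shatTotalSlope_mono hn hD ht hδ (by nlinarith)) h
      · exact mul_le_mul_of_nonpos_left (shatTotalSlope_mono hn hD ht hδ (by nlinarith)) h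
    · intro x hx y hy hxy
      have e : deriv g y - deriv g x = EuclideanSpace.single (0 : Fin (d + 1))
          (w 0 * (shatSlope n D t δ (y * w 0 + b 0) - shatSlope n D t δ (x * w 0 + b 0))) := by
        ext i
        by_cases hi : i = 0
        · subst hi
          simp only [PiLp.sub_apply, hd0 x hx, hd0 y hy, PiLp.single_apply, if_true]
          ring
        · simp only [PiLp.sub_apply, hdi i hi x hx, hdi i hi y hy, PiLp.single_apply, hi,
            if_false, sub_self]
      rw [edist_eq_enorm_sub, ← ofReal_norm, e, PiLp.norm_single, norm_mul,
        Real.norm_eq_abs, Real.norm_eq_abs]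
      refine ENNReal.ofReal_le_ofReal ?_
      simp only
      rcases le_total 0 (w 0) with h | h
      · rw [abs_of_nonneg h, ← mul_sub]
        exact mul_le_mul_of_nonneg_left (abs_shatSlope_sub_le hn hD ht hδ (by nlinarith)) h
      · rw [abs_of_nonpos h, abs_sub_comm, ← mul_sub, ← neg_sub (shatTotalSlope _ _ _ _ _),
          mul_neg, ← neg_mul]
        exact mul_le_mul_of_nonneg_left (abs_shatSlope_sub_le hn hD ht hδ (by nlinarith))
          (neg_nonneg.2 h)
    · intro x y _
      have hB : ∀ u v, |shatTotalSlope n D t δ u - shatTotalSlope n D t δ v| ≤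
          2 * ((n : ℝ) - 1) * (D / ((n : ℝ) - 1)) / (t * (D / ((n : ℝ) - 1) - δ)) := fun u v => by
        rw [abs_sub_le_iff]
        exact ⟨shatTotalSlope_sub_le hn hD ht hδ v u, shatTotalSlope_sub_le hn hD ht hδ u v⟩
      simp only
      rw [← mul_sub]
      refine (le_abs_self _).trans ?_
      rw [abs_mul]
      refine (mul_le_of_le_one_left (abs_nonneg _) hw0).trans (hB _ _)
  · have hn3 : (2 : ℝ) ≤ n := by exact_mod_cast hn
    have hΔ0 : 0 < D / ((n : ℝ) - 1) := div_pos hD (by linarith)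
    have hw : ‖(EuclideanSpace.single (0 : Fin (d + 1)) (1 : ℝ))‖ = 1 := by simp
    have h0 : (fun x : ℝ => svec (x • EuclideanSpace.single (0 : Fin (d + 1)) (1 : ℝ) + 0) 0) =
        s := by
      funext x; simp [hsv]
    have hdiff : ∀ x, DifferentiableAt ℝ s x → DifferentiableAt ℝ
        (fun x : ℝ => svec (x • EuclideanSpace.single (0 : Fin (d + 1)) (1 : ℝ) + 0)) x := by
      intro x hx
      rw [differentiableAt_euclidean]
      intro i
      by_cases hi : i = 0
      · subst hi
        rwa [h0]
      · simp [hsv, hi]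
    have hp : ∀ k ≤ n - 1, HasDerivAt s (-1 / t) (trainPt n D (k + 1)) := fun k hk =>
      hs.hasDerivAt_trainPt hn hδ.1 hk
    have hq : ∀ k < n - 1, HasDerivAt s (δ / (D / ((n : ℝ) - 1) - δ) / t)
        (trainPt n D (k + 1) + D / ((n : ℝ) - 1)) := fun k hk => hs.hasDerivAt_midpoint hδ.2 hk
    refine Eq.trans_le ?_ (ofReal_zigzag_le_RnsD svec hw 0 0 (n - 1) (fun k => trainPt n D (k + 1))
      (fun k => trainPt n D (k + 1) + D / ((n : ℝ) - 1))
      (fun k hk => hdiff _ (hp k hk).differentiableAt)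
      (fun k hk => hdiff _ (hq k hk).differentiableAt) (fun k _ => by linarith)
      (fun k _ => by rw [trainPt_succ, trainPt_succ]; push_cast; linarith))
    rw [h0]
    congr 1
    have : ∀ k ∈ Finset.range (n - 1),
        ((deriv s (trainPt n D (k + 1) + D / ((n : ℝ) - 1)) - deriv s (trainPt n D (k + 1))) +
        (deriv s (trainPt n D (k + 1) + D / ((n : ℝ) - 1)) - deriv s (trainPt n D (k + 1 + 1)))) =
        2 * (D / ((n : ℝ) - 1)) / (t * (D / ((n : ℝ) - 1) - δ)) := by
      intro k hk
      have hk := Finset.mem_range.1 hk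
      rw [(hq k hk).deriv, (hp k hk.le).deriv, (hp (k + 1) hk).deriv]
      have : D / ((n : ℝ) - 1) - δ ≠ 0 := (sub_pos.2 hδ.2).ne'
      generalize D / ((n : ℝ) - 1) = Δ at *
      field_simp
      ring
    rw [Finset.sum_congr rfl this, Finset.sum_const, Finset.card_range, nsmul_eq_mul,
      Nat.cast_sub (by omega), Nat.cast_one]
    ring

end Lines

section Multi

variable {n d : ℕ} {D t : ℝ}

local notation "𝔼" => EuclideanSpace ℝ (Fin (d + 1))

/-- The score of the multi-dimensional noised empirical density. -/
noncomputable def scoreVec (n : ℕ) (D : ℝ) (d : ℕ) (t : ℝ) (x : EuclideanSpace ℝ (Fin (d + 1))) :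
    EuclideanSpace ℝ (Fin (d + 1)) :=
  WithLp.toLp 2 fun i => if i = 0 then scoreEmp n D t (x 0) else -(x i) / t

theorem hasDerivAt_log_gaussD (ht : 0 < t) (x : ℝ) :
    HasDerivAt (fun x => Real.log (gaussD x (√t))) (-x / t) x := by
  have h := (hasDerivAt_gaussD_sub ht 0 x).log (gaussD_pos _ (Real.sqrt_pos.2 ht)).ne'
  simp only [sub_zero, zero_sub] at h
  rwa [mul_div_cancel_left₀ _ (gaussD_pos _ (Real.sqrt_pos.2 ht)).ne'] at h

theorem hasGradientAt_log_pEmpD (hn : 2 ≤ n) (ht : 0 < t) (x : 𝔼) :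
    HasGradientAt (fun y => Real.log (pEmpD n D d t y)) (scoreVec n D d t x) x := by
  have hφ : ∀ x, gaussD x (√t) ≠ 0 := fun x => (gaussD_pos x (Real.sqrt_pos.2 ht)).ne'
  have h1 : (fun y : 𝔼 => Real.log (pEmpD n D d t y)) = fun y : 𝔼 =>
      Real.log (pEmp n D t (y 0)) +
        ∑ i ∈ Finset.univ.erase (0 : Fin (d + 1)), Real.log (gaussD (y i) (√t)) := by
    funext y
    unfold pEmpD
    rw [Real.log_mul (pEmp_pos hn ht _).ne' (Finset.prod_ne_zero_iff.2 fun i _ => hφ _),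
      Real.log_prod fun i _ => hφ _]
  rw [h1, hasGradientAt_iff_hasFDerivAt]
  have hproj : ∀ i, HasFDerivAt (fun y : 𝔼 => y i) (EuclideanSpace.proj (𝕜 := ℝ) i) x := fun i =>
    (EuclideanSpace.proj (𝕜 := ℝ) i).hasFDerivAt
  have h2 := ((hasDerivAt_log_pEmp (D := D) hn ht (x 0)).comp_hasFDerivAt x (hproj 0)).add
    (HasFDerivAt.fun_sum (u := Finset.univ.erase (0 : Fin (d + 1))) fun i _ =>
      (hasDerivAt_log_gaussD ht (x i)).comp_hasFDerivAt x (hproj i))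
  refine h2.congr_fderiv ?_
  ext v
  rw [InnerProductSpace.toDual_apply_apply, PiLp.inner_apply,
    ← Finset.add_sum_erase _ _ (Finset.mem_univ (0 : Fin (d + 1)))]
  simp only [add_apply, sum_apply, smul_apply, smul_eq_mul, scoreVec, if_true,
    RCLike.inner_apply, conj_trivial]
  rw [mul_comm]
  congr 1
  refine Finset.sum_congr rfl fun i hi => ?_
  rw [if_neg (Finset.ne_of_mem_erase hi), mul_comm]
  rfl

theorem scoreLossD_eq (hn : 2 ≤ n) (ht : 0 < t) (f : 𝔼 → 𝔼) :
    scoreLossD n D d t f = t * ∫ x, ‖f x - scoreVec n D d t x‖ ^ 2 * pEmpD n D d t x := by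
  unfold scoreLossD
  simp_rw [(hasGradientAt_log_pEmpD hn ht _).gradient]

theorem pEmpD_eq (x : 𝔼) :
    pEmpD n D d t x = pEmp n D t (x 0) * ∏ i : Fin d, gaussD (x i.succ) (√t) := by
  unfold pEmpD
  have : Finset.univ.erase (0 : Fin (d + 1)) = Finset.univ.map (Fin.succEmb d) := by
    ext i
    refine Fin.cases ?_ (fun j => ?_) i <;> simp
  rw [this, Finset.prod_map]
  rfl

theorem pEmpD_pos (hn : 2 ≤ n) (ht : 0 < t) (x : 𝔼) : 0 < pEmpD n D d t x := by
  rw [pEmpD_eq]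
  exact mul_pos (pEmp_pos hn ht _)
    (Finset.prod_pos fun i _ => gaussD_pos _ (Real.sqrt_pos.2 ht))

/-- The point with first coordinate `x` and remaining coordinates `c`. -/
noncomputable def consPt (x : ℝ) (c : Fin d → ℝ) : 𝔼 := WithLp.toLp 2 (Fin.cons x c)

@[simp] theorem consPt_zero (x : ℝ) (c : Fin d → ℝ) : consPt x c 0 = x := rfl

@[simp] theorem consPt_succ (x : ℝ) (c : Fin d → ℝ) (i : Fin d) : consPt x c i.succ = c i := rfl

theorem consPt_eq (x : ℝ) (c : Fin d → ℝ) :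
    consPt x c = x • EuclideanSpace.single (0 : Fin (d + 1)) (1 : ℝ) + consPt 0 c := by
  ext i
  refine Fin.cases ?_ (fun j => ?_) i <;> simp

theorem pEmpD_consPt (x : ℝ) (c : Fin d → ℝ) :
    pEmpD n D d t (consPt x c) = pEmp n D t x * ∏ i : Fin d, gaussD (c i) (√t) := by
  simp [pEmpD_eq]

theorem exists_measurableEquiv_consPt (d : ℕ) :
    ∃ e : ℝ × (Fin d → ℝ) ≃ᵐ EuclideanSpace ℝ (Fin (d + 1)), MeasurePreserving e ∧
      ∀ z, e z = consPt z.1 z.2 := by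
  refine ⟨(MeasurableEquiv.piFinSuccAbove (fun _ : Fin (d + 1) => ℝ) 0).symm.trans
    (MeasurableEquiv.toLp 2 (Fin (d + 1) → ℝ)), ?_, fun z => ?_⟩
  · exact (PiLp.volume_preserving_toLp (Fin (d + 1))).comp
      ((volume_preserving_piFinSuccAbove (fun _ : Fin (d + 1) => ℝ) 0).symm _)
  · change WithLp.toLp 2 (Fin.insertNth (α := fun _ => ℝ) 0 z.1 z.2) = _
    rw [Fin.insertNth_zero']
    rfl

theorem integral_consPt (H : 𝔼 → ℝ) :
    ∫ z : ℝ × (Fin d → ℝ), H (consPt z.1 z.2) = ∫ x, H x := by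
  obtain ⟨e, he, hez⟩ := exists_measurableEquiv_consPt d
  simp_rw [← hez]
  exact he.integral_comp' H

theorem integrable_consPt_iff {H : 𝔼 → ℝ} :
    (Integrable fun z : ℝ × (Fin d → ℝ) => H (consPt z.1 z.2)) ↔ Integrable H := by
  obtain ⟨e, he, hez⟩ := exists_measurableEquiv_consPt d
  simp_rw [← hez]
  exact he.integrable_comp_emb e.measurableEmbedding

theorem integral_prod_gaussD (ht : 0 < t) :
    ∫ c : Fin d → ℝ, ∏ i, gaussD (c i) (√t) = 1 := by
  rw [integral_fintype_prod_volume_eq_prod (fun _ x => gaussD x (√t))]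
  simp [integral_gaussD_sqrt ht]

theorem integrable_prod_gaussD (ht : 0 < t) :
    Integrable fun c : Fin d → ℝ => ∏ i, gaussD (c i) (√t) :=
  Integrable.fintype_prod fun _ => integrable_gaussD_sqrt ht

theorem sq_apply_zero_le (v : 𝔼) : v 0 ^ 2 ≤ ‖v‖ ^ 2 := by
  rw [← sq_abs]
  exact pow_le_pow_left₀ (abs_nonneg _) (PiLp.norm_apply_le v 0) 2

theorem scoreLossD_of_first_coord (hn : 2 ≤ n) (ht : 0 < t) {s : ℝ → ℝ} {svec : 𝔼 → 𝔼}
    (hsv : ∀ x i, svec x i = if i = 0 then s (x 0) else -(x i) / t) :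
    scoreLossD n D d t svec = t * ∫ x, (s x - scoreEmp n D t x) ^ 2 * pEmp n D t x := by
  rw [scoreLossD_eq hn ht, ← integral_consPt]
  have h : ∀ z : ℝ × (Fin d → ℝ), ‖svec (consPt z.1 z.2) - scoreVec n D d t (consPt z.1 z.2)‖ ^ 2 *
      pEmpD n D d t (consPt z.1 z.2) =
      ((s z.1 - scoreEmp n D t z.1) ^ 2 * pEmp n D t z.1) * ∏ i : Fin d, gaussD (z.2 i) (√t) := by
    intro z
    rw [pEmpD_consPt, EuclideanSpace.real_norm_sq_eq, Fin.sum_univ_succ]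
    simp only [PiLp.sub_apply, hsv, scoreVec, if_true, Fin.succ_ne_zero, if_false, sub_self,
      consPt_zero]
    simp [mul_assoc]
  simp_rw [h]
  congr 1
  have := integral_prod_mul (μ := (volume : Measure ℝ)) (ν := (volume : Measure (Fin d → ℝ)))
    (fun x => (s x - scoreEmp n D t x) ^ 2 * pEmp n D t x) (fun c => ∏ i, gaussD (c i) (√t))
  rw [integral_prod_gaussD ht, mul_one] at this
  exact this

/-- Some line parallel to the first axis carries a first component of small loss. -/
theorem exists_slice_loss_lt (hn : 2 ≤ n) (ht : 0 < t) {ε : ℝ} {f : 𝔼 → 𝔼} (hf : Continuous f)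
    (hint : Integrable fun x => ‖f x - scoreVec n D d t x‖ ^ 2 * pEmpD n D d t x)
    (hloss : scoreLossD n D d t f < ε) :
    ∃ c : Fin d → ℝ,
      (Integrable fun x => (f (consPt x c) 0 - scoreEmp n D t x) ^ 2 * pEmp n D t x) ∧
      t * ∫ x, (f (consPt x c) 0 - scoreEmp n D t x) ^ 2 * pEmp n D t x < ε := by
  have hline : ∀ c : Fin d → ℝ, Continuous fun x : ℝ => f (consPt x c) 0 := fun c => by
    have h1 : Continuous fun x : ℝ => consPt x c := by
      rw [funext fun x => consPt_eq x c]
      fun_prop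
    exact (EuclideanSpace.proj (𝕜 := ℝ) (0 : Fin (d + 1))).continuous.comp (hf.comp h1)
  set H : 𝔼 → ℝ := fun x => ‖f x - scoreVec n D d t x‖ ^ 2 * pEmpD n D d t x with hH
  have hint' := integrable_consPt_iff.2 hint
  have hsec := hint'.prod_left_ae
  have hfub := integral_prod_symm _ hint'
  have hΦ : ∀ c : Fin d → ℝ, 0 < ∏ i, gaussD (c i) (√t) := fun c =>
    Finset.prod_pos fun i _ => gaussD_pos _ (Real.sqrt_pos.2 ht)
  have hle : ∀ c x, (f (consPt x c) 0 - scoreEmp n D t x) ^ 2 * pEmp n D t x ≤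
      (∏ i, gaussD (c i) (√t))⁻¹ * H (consPt x c) := by
    intro c x
    simp only [hH]
    rw [pEmpD_consPt, le_inv_mul_iff₀ (hΦ c)]
    have h1 := sq_apply_zero_le (f (consPt x c) - scoreVec n D d t (consPt x c))
    have h2 : (f (consPt x c) - scoreVec n D d t (consPt x c)) 0 =
      f (consPt x c) 0 - scoreEmp n D t x := rfl
    rw [h2] at h1
    have := mul_le_mul_of_nonneg_right h1
      (mul_pos (pEmp_pos (D := D) hn ht x) (hΦ c)).le
    linarith
  have hsec' : ∀ᵐ c : Fin d → ℝ,
      Integrable fun x => (f (consPt x c) 0 - scoreEmp n D t x) ^ 2 * pEmp n D t x := by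
    filter_upwards [hsec] with c hc
    refine (hc.const_mul (∏ i, gaussD (c i) (√t))⁻¹).mono' ?_ (ae_of_all _ fun x => ?_)
    · exact ((((hline c).sub (continuous_scoreEmp hn ht)).pow 2).mul
        continuous_pEmp).aestronglyMeasurable
    · rw [Real.norm_of_nonneg (mul_nonneg (sq_nonneg _) (pEmp_pos hn ht x).le)]
      exact hle c x
  by_contra! hcon
  have hge : ∀ᵐ c : Fin d → ℝ,
      ε * ∏ i, gaussD (c i) (√t) ≤ t * ∫ x, H (consPt x c) := by
    filter_upwards [hsec, hsec'] with c hc hc'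
    have h1 := hcon c hc'
    have h2 := integral_mono hc' (hc.const_mul (∏ i, gaussD (c i) (√t))⁻¹) (hle c)
    rw [integral_const_mul] at h2
    have h3 := h1.trans (mul_le_mul_of_nonneg_left h2 ht.le)
    have h4 := mul_le_mul_of_nonneg_right h3 (hΦ c).le
    refine h4.trans_eq ?_
    have := (hΦ c).ne'
    field_simp
  have h1 := integral_mono_ae ((integrable_prod_gaussD ht).const_mul ε)
    (hint'.integral_prod_right.const_mul t) hge
  rw [integral_const_mul, integral_const_mul, integral_prod_gaussD ht, mul_one] at h1
  rw [scoreLossD_eq hn ht, ← integral_consPt] at hloss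
  have h2 : ∫ z : ℝ × (Fin d → ℝ), H (consPt z.1 z.2) = ∫ c, ∫ x, H (consPt x c) := hfub
  rw [← h2] at h1
  exact absurd hloss (not_lt.2 h1)

end Multi

/-- On every line, difference quotients of `F` differ by at most `R`. -/
def LineSlopeBound {E : Type*} [NormedAddCommGroup E] [NormedSpace ℝ E] (F : E → ℝ) (R : ℝ) :
    Prop :=
  ∀ w b : E, ‖w‖ = 1 → ∀ p q p' q' : ℝ, p < q → p' < q' →
    (F (q • w + b) - F (p • w + b)) / (q - p) - (F (q' • w + b) - F (p' • w + b)) / (q' - p') ≤ R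

theorem slope_sub_slope_le {g : ℝ → ℝ} (hg : Continuous g) {S : Set ℝ} (hS : S.Finite)
    (hd : ∀ x ∉ S, DifferentiableAt ℝ g x) {R : ℝ}
    (hR : ∀ x ∉ S, ∀ y ∉ S, deriv g x - deriv g y ≤ R) {p q p' q' : ℝ} (h : p < q)
    (h' : p' < q') : (g q - g p) / (q - p) - (g q' - g p') / (q' - p') ≤ R := by
  obtain ⟨c, -, hc, hcs⟩ := exists_slope_le_deriv hg hS hd h
  obtain ⟨c', -, hc', hcs'⟩ := exists_deriv_le_slope hg hS hd h'
  have h1 := (div_le_iff₀ (sub_pos.2 h)).2 hcs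
  have h2 := (le_div_iff₀ (sub_pos.2 h')).2 hcs'
  linarith [hR c hc c' hc']

section SlopeBound

variable {E : Type*} [NormedAddCommGroup E] [NormedSpace ℝ E] {F : E → ℝ} {R : ℝ}

theorem LineSlopeBound.midpoint_le (hF : LineSlopeBound F R) (u v : E) :
    |2 * F ((1 / 2 : ℝ) • (u + v)) - F u - F v| ≤ R * ‖v - u‖ / 2 := by
  rcases eq_or_ne u v with rfl | huv
  · rw [← two_smul ℝ u, smul_smul, show (1 / 2 : ℝ) * 2 = 1 by norm_num, one_smul, sub_self,
      norm_zero, mul_zero, zero_div, show 2 * F u - F u - F u = 0 by ring, abs_zero]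
  have hL : 0 < ‖v - u‖ := norm_pos_iff.2 (sub_ne_zero.2 huv.symm)
  have hw : ‖‖v - u‖⁻¹ • (v - u)‖ = 1 := by
    rw [norm_smul, norm_inv, norm_norm, inv_mul_cancel₀ hL.ne']
  have key := hF _ u hw
  have h2 : (‖v - u‖ / 2) • (‖v - u‖⁻¹ • (v - u)) + u = (1 / 2 : ℝ) • (u + v) := by
    rw [smul_smul, show ‖v - u‖ / 2 * ‖v - u‖⁻¹ = 1 / 2 by field_simp]
    module
  have h3 : ‖v - u‖ • (‖v - u‖⁻¹ • (v - u)) + u = v := by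
    rw [smul_smul, mul_inv_cancel₀ hL.ne', one_smul, sub_add_cancel]
  have k1 := key 0 (‖v - u‖ / 2) (‖v - u‖ / 2) ‖v - u‖ (by linarith) (by linarith)
  have k2 := key (‖v - u‖ / 2) ‖v - u‖ 0 (‖v - u‖ / 2) (by linarith) (by linarith)
  rw [zero_smul, zero_add, h2, h3, sub_zero, show ‖v - u‖ - ‖v - u‖ / 2 = ‖v - u‖ / 2 by ring,
    ← sub_div, div_le_iff₀ (by linarith)] at k1 k2
  rw [abs_le]
  constructor <;> linarith

theorem LineSlopeBound.abs_axis_le (hF : LineSlopeBound F R) (x₀ : E) {e : E} (he : ‖e‖ = 1)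
    (T : ℝ) : |F (x₀ + T • e) - F x₀| ≤ (R + |F (x₀ + e) - F x₀|) * |T| := by
  have key := hF e x₀ he
  have h0 : (0 : ℝ) • e + x₀ = x₀ := by simp
  have h1 : (1 : ℝ) • e + x₀ = x₀ + e := by rw [one_smul, add_comm]
  have hT : T • e + x₀ = x₀ + T • e := add_comm _ _
  have habs := abs_le.1 (le_refl |F (x₀ + e) - F x₀|)
  have fin : ∀ q, q ≤ R + |F (x₀ + e) - F x₀| → -q ≤ R + |F (x₀ + e) - F x₀| →
      |q * T| ≤ (R + |F (x₀ + e) - F x₀|) * |T| := fun q h1 h2 => by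
    rw [abs_mul]
    exact mul_le_mul_of_nonneg_right (abs_le.2 ⟨by linarith, h1⟩) (abs_nonneg _)
  rcases lt_trichotomy T 0 with h | rfl | h
  · have k1 := key T 0 0 1 h one_pos
    have k2 := key 0 1 T 0 one_pos h
    rw [h0, h1, hT, sub_zero, div_one] at k1 k2
    have := fin ((F x₀ - F (x₀ + T • e)) / (0 - T)) (by linarith) (by linarith)
    rwa [zero_sub, div_neg, neg_mul, div_mul_cancel₀ _ h.ne, neg_sub] at this
  · simp
  · have k1 := key 0 T 0 1 h one_pos
    have k2 := key 0 1 0 T one_pos h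
    rw [h0, h1, hT, sub_zero, sub_zero, div_one] at k1 k2
    have := fin ((F (x₀ + T • e) - F x₀) / T) (by linarith) (by linarith)
    rwa [div_mul_cancel₀ _ h.ne'] at this

end SlopeBound

section Regularity

variable {d : ℕ}

local notation "𝔼" => EuclideanSpace ℝ (Fin (d + 1))

theorem norm_sum_single_le (A : Finset (Fin (d + 1))) (h : 𝔼) :
    ‖∑ i ∈ A, EuclideanSpace.single i (h i)‖ ≤ A.card * ‖h‖ := by
  rw [← nsmul_eq_mul]
  refine (norm_sum_le _ _).trans (Finset.sum_le_card_nsmul _ _ _ fun i _ => ?_)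
  rw [PiLp.norm_single]
  exact PiLp.norm_apply_le h i

theorem LineSlopeBound.exists_abs_sub_le {F : 𝔼 → ℝ} {R : ℝ} (hF : LineSlopeBound F R)
    (hR : 0 ≤ R) (x₀ : 𝔼) : ∃ K, 0 ≤ K ∧ ∀ h, |F (x₀ + h) - F x₀| ≤ K * ‖h‖ := by
  have key : ∀ A : Finset (Fin (d + 1)), ∃ K, 0 ≤ K ∧ ∀ h : 𝔼,
      |F (x₀ + ∑ i ∈ A, EuclideanSpace.single i (h i)) - F x₀| ≤ K * ‖h‖ := by
    intro A
    induction A using Finset.induction_on with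
    | empty => exact ⟨0, le_rfl, fun h => by simp⟩
    | insert i A hi ih =>
      obtain ⟨K, hK0, hK⟩ := ih
      have he : ‖(EuclideanSpace.single i (1 : ℝ) : 𝔼)‖ = 1 := by simp
      set B := R + |F (x₀ + EuclideanSpace.single i (1 : ℝ)) - F x₀| with hB
      have hB0 : 0 ≤ B := by positivity
      refine ⟨B + K + R * (1 + A.card) / 2, by positivity, fun h => ?_⟩
      rw [Finset.sum_insert hi]
      set a : 𝔼 := EuclideanSpace.single i (h i) with ha
      set b : 𝔼 := ∑ i ∈ A, EuclideanSpace.single i (h i) with hb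
      have hhi : |h i| ≤ ‖h‖ := PiLp.norm_apply_le h i
      have h1 : |F (x₀ + (2 : ℝ) • a) - F x₀| ≤ 2 * B * ‖h‖ := by
        have := hF.abs_axis_le x₀ he (2 * h i)
        rw [abs_mul, abs_two] at this
        have e : (2 * h i) • (EuclideanSpace.single i (1 : ℝ) : 𝔼) = (2 : ℝ) • a := by
          rw [mul_smul]
          congr 1
          ext j
          simp [ha, PiLp.single_apply]
        rw [e] at this
        nlinarith
      have h2 : |F (x₀ + (2 : ℝ) • b) - F x₀| ≤ 2 * K * ‖h‖ := by
        have := hK ((2 : ℝ) • h)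
        rw [norm_smul, Real.norm_two] at this
        have e : ∑ i ∈ A, EuclideanSpace.single i (((2 : ℝ) • h) i) = (2 : ℝ) • b := by
          rw [hb, Finset.smul_sum]
          refine Finset.sum_congr rfl fun i _ => ?_
          ext j
          simp [PiLp.single_apply]
        rw [e] at this
        linarith
      have h3 := hF.midpoint_le (x₀ + (2 : ℝ) • a) (x₀ + (2 : ℝ) • b)
      have e3 : (1 / 2 : ℝ) • (x₀ + (2 : ℝ) • a + (x₀ + (2 : ℝ) • b)) = x₀ + (a + b) := by module
      have e4 : ‖x₀ + (2 : ℝ) • b - (x₀ + (2 : ℝ) • a)‖ ≤ 2 * (1 + A.card) * ‖h‖ := by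
        have hb' : ‖b‖ ≤ A.card * ‖h‖ := norm_sum_single_le A h
        have ha' : ‖a‖ ≤ ‖h‖ := by rw [ha, PiLp.norm_single]; exact hhi
        rw [show x₀ + (2 : ℝ) • b - (x₀ + (2 : ℝ) • a) = (2 : ℝ) • (b - a) by module, norm_smul,
          Real.norm_two]
        linarith [norm_sub_le b a]
      rw [e3] at h3
      have e5 := mul_le_mul_of_nonneg_left e4 hR
      rw [abs_le] at h1 h2 h3 ⊢
      constructor <;> linarith [h1.1, h1.2, h2.1, h2.2, h3.1, h3.2]
  obtain ⟨K, hK0, hK⟩ := key Finset.univ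
  refine ⟨K, hK0, fun h => ?_⟩
  have e : ∑ i, EuclideanSpace.single i (h i) = h := by
    ext j
    simp
  simpa only [e] using hK h

theorem LineSlopeBound.continuous {F : 𝔼 → ℝ} {R : ℝ} (hF : LineSlopeBound F R) (hR : 0 ≤ R) :
    Continuous F := by
  refine continuous_iff_continuousAt.2 fun x₀ => ?_
  obtain ⟨K, -, hK⟩ := hF.exists_abs_sub_le hR x₀
  rw [ContinuousAt, tendsto_iff_norm_sub_tendsto_zero]
  have h1 : Tendsto (fun x => K * ‖x - x₀‖) (nhds x₀) (nhds 0) := by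
    have : Continuous fun x : 𝔼 => K * ‖x - x₀‖ := by fun_prop
    simpa using this.tendsto x₀
  refine squeeze_zero (fun _ => norm_nonneg _) (fun x => ?_) h1
  have := hK (x - x₀)
  rwa [add_sub_cancel] at this

/-- The components of a map of finite non-smoothness measure have bounded slope differences. -/
theorem lineSlopeBound_of_RnsD {f : 𝔼 → 𝔼}
    (hf : ∀ (w b : 𝔼), ‖w‖ = 1 →
      Continuous (fun x : ℝ => f (x • w + b)) ∧
      {x : ℝ | ¬ DifferentiableAt ℝ (fun x : ℝ => f (x • w + b)) x}.Finite)
    (hR : RnsD d f ≠ ∞) (i : Fin (d + 1)) :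
    LineSlopeBound (fun x => f x i) (RnsD d f).toReal := by
  intro w b hw p q p' q' h h'
  obtain ⟨hc, hfin⟩ := hf w b hw
  refine slope_sub_slope_le (g := fun x : ℝ => f (x • w + b) i)
    ((EuclideanSpace.proj (𝕜 := ℝ) i).continuous.comp hc) hfin
    (fun x hx => (deriv_euclidean_apply (not_not.1 hx) i).differentiableAt)
    (fun x hx y hy => ?_) h h'
  have hx' := not_not.1 hx
  have hy' := not_not.1 hy
  rw [(deriv_euclidean_apply hx' i).deriv, (deriv_euclidean_apply hy' i).deriv]
  have h1 : edist (deriv (fun x : ℝ => f (x • w + b)) x) (deriv (fun x : ℝ => f (x • w + b)) y) ≤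
      RnsD d f :=
    (eVariationOn.edist_le (s := {x | DifferentiableAt ℝ (fun x : ℝ => f (x • w + b)) x}) _
      hx' hy').trans
      (le_iSup_of_le w (le_iSup_of_le hw (le_iSup_of_le b le_rfl)))
  rw [edist_dist, ENNReal.ofReal_le_iff_le_toReal hR, dist_eq_norm] at h1
  exact ((le_abs_self _).trans (PiLp.norm_apply_le (_ - _ : 𝔼) i)).trans h1

theorem continuous_of_RnsD {f : 𝔼 → 𝔼}
    (hf : ∀ (w b : 𝔼), ‖w‖ = 1 →
      Continuous (fun x : ℝ => f (x • w + b)) ∧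
      {x : ℝ | ¬ DifferentiableAt ℝ (fun x : ℝ => f (x • w + b)) x}.Finite)
    (hR : RnsD d f ≠ ∞) : Continuous f := by
  have h : ∀ i, Continuous fun x => f x i := fun i =>
    (lineSlopeBound_of_RnsD hf hR i).continuous ENNReal.toReal_nonneg
  exact (PiLp.continuous_toLp 2 _).comp (continuous_pi h)

end Regularity

section Integrability

variable {n d : ℕ} {D t : ℝ}

local notation "𝔼" => EuclideanSpace ℝ (Fin (d + 1))

theorem integrable_sq_mul_gaussD_sqrt (ht : 0 < t) :
    Integrable fun x : ℝ => x ^ 2 * gaussD x (√t) := by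
  refine (integrable_comp_mul_left_iff _ (Real.sqrt_pos.2 ht).ne').1 ?_
  refine (integrable_sq_mul_gaussD.const_mul (√t)).congr (ae_of_all _ fun u => ?_)
  have : √t ≠ 0 := (Real.sqrt_pos.2 ht).ne'
  simp only [gaussD_sqrt_mul ht]
  field_simp

theorem integrable_one_add_sq_mul_gaussD_sub (ht : 0 < t) (y : ℝ) :
    Integrable fun x : ℝ => (1 + x ^ 2) * gaussD (x - y) (√t) := by
  have h : Integrable fun x : ℝ => (1 + (x + y) ^ 2) * gaussD x (√t) := by
    refine (((integrable_gaussD_sqrt ht).const_mul (1 + 2 * y ^ 2)).add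
      ((integrable_sq_mul_gaussD_sqrt ht).const_mul 2)).mono' (by fun_prop)
      (ae_of_all _ fun x => ?_)
    have hg := gaussD_pos x (Real.sqrt_pos.2 ht)
    rw [Real.norm_of_nonneg (by positivity), Pi.add_apply]
    have : 1 + (x + y) ^ 2 ≤ 1 + 2 * y ^ 2 + 2 * x ^ 2 := by nlinarith [sq_nonneg (x - y)]
    have := mul_le_mul_of_nonneg_right this hg.le
    linarith
  simpa using h.comp_sub_right y

theorem integrable_one_add_sq_mul_pEmp (ht : 0 < t) :
    Integrable fun x : ℝ => (1 + x ^ 2) * pEmp n D t x := by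
  refine ((integrable_finsetSum (Finset.Icc 1 n) fun k _ =>
    integrable_one_add_sq_mul_gaussD_sub ht (trainPt n D k)).const_mul (1 / (n : ℝ))).congr
    (ae_of_all _ fun x => ?_)
  simp only [pEmp, Finset.mul_sum]
  exact Finset.sum_congr rfl fun k _ => by ring

theorem one_add_sum_le_prod {ι : Type*} (A : Finset ι) {a : ι → ℝ} (ha : ∀ i, 0 ≤ a i) :
    1 + ∑ i ∈ A, a i ≤ ∏ i ∈ A, (1 + a i) := by
  classical
  induction A using Finset.induction_on with
  | empty => simp
  | insert i A hi ih =>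
    rw [Finset.sum_insert hi, Finset.prod_insert hi]
    have h1 := mul_le_mul_of_nonneg_left ih (add_nonneg zero_le_one (ha i))
    have h2 := mul_nonneg (ha i) (Finset.sum_nonneg fun j (_ : j ∈ A) => ha j)
    linarith

theorem integrable_one_add_norm_sq_mul_pEmpD (hn : 2 ≤ n) (ht : 0 < t) :
    Integrable fun x : 𝔼 => (1 + ‖x‖ ^ 2) * pEmpD n D d t x := by
  have hcont : Continuous fun x : 𝔼 => (1 + ‖x‖ ^ 2) * pEmpD n D d t x := by
    unfold pEmpD
    fun_prop
  have h1 : Integrable fun x : 𝔼 => (∏ i, (1 + x i ^ 2)) * pEmpD n D d t x := by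
    rw [← integrable_consPt_iff]
    have hφ := integrable_one_add_sq_mul_gaussD_sub ht 0
    simp only [sub_zero] at hφ
    have h2 : Integrable fun c : Fin d → ℝ => ∏ i, (1 + c i ^ 2) * gaussD (c i) (√t) :=
      Integrable.fintype_prod fun _ => hφ
    refine ((integrable_one_add_sq_mul_pEmp (n := n) (D := D) ht).mul_prod h2).congr
      (ae_of_all _ fun z => ?_)
    simp only [pEmpD_consPt, Fin.prod_univ_succ, consPt_zero, consPt_succ,
      Finset.prod_mul_distrib]
    ring
  refine h1.mono' hcont.aestronglyMeasurable (ae_of_all _ fun x => ?_)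
  have hp := (pEmpD_pos (D := D) hn ht x).le
  rw [Real.norm_of_nonneg (by positivity), EuclideanSpace.real_norm_sq_eq]
  exact mul_le_mul_of_nonneg_right (one_add_sum_le_prod _ fun i => sq_nonneg _) hp

theorem continuous_scoreVec (hn : 2 ≤ n) (ht : 0 < t) : Continuous (scoreVec n D d t) := by
  refine (PiLp.continuous_toLp 2 _).comp (continuous_pi fun i => ?_)
  by_cases hi : i = 0
  · simp only [hi, if_true]
    exact (continuous_scoreEmp hn ht).comp
      (EuclideanSpace.proj (𝕜 := ℝ) (0 : Fin (d + 1))).continuous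
  · simp only [hi, if_false]
    fun_prop

theorem abs_scoreVec_apply_le (hn : 2 ≤ n) (hD : 0 < D) (ht : 0 < t) (x : 𝔼) (i : Fin (d + 1)) :
    |scoreVec n D d t x i| ≤ (D + ‖x‖) / t := by
  have hx : ∀ i, |x i| ≤ ‖x‖ := fun i => PiLp.norm_apply_le x i
  by_cases hi : i = 0
  · simp only [scoreVec, hi, if_true]
    refine (abs_scoreEmp_le hn hD ht _).trans ?_
    gcongr
    exact hx 0
  · simp only [scoreVec, hi, if_false]
    rw [abs_div, abs_neg, abs_of_pos ht]
    gcongr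
    linarith [hx i]

/-- Finite non-smoothness measure forces the loss integrand to be integrable. -/
theorem integrable_loss_of_RnsD (hn : 2 ≤ n) (hD : 0 < D) (ht : 0 < t) {f : 𝔼 → 𝔼}
    (hf : ∀ (w b : 𝔼), ‖w‖ = 1 →
      Continuous (fun x : ℝ => f (x • w + b)) ∧
      {x : ℝ | ¬ DifferentiableAt ℝ (fun x : ℝ => f (x • w + b)) x}.Finite)
    (hR : RnsD d f ≠ ∞) :
    Integrable fun x => ‖f x - scoreVec n D d t x‖ ^ 2 * pEmpD n D d t x := by
  have hcont := continuous_of_RnsD hf hR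
  choose K hK0 hK using fun i =>
    (lineSlopeBound_of_RnsD hf hR i).exists_abs_sub_le ENNReal.toReal_nonneg 0
  have hmeas : Continuous fun x => ‖f x - scoreVec n D d t x‖ ^ 2 * pEmpD n D d t x := by
    have := continuous_scoreVec (d := d) (D := D) hn ht
    unfold pEmpD
    fun_prop
  refine ((integrable_one_add_norm_sq_mul_pEmpD (d := d) (D := D) hn ht).const_mul
    (∑ i, 2 * (|f 0 i| + K i + (D + 1) / t) ^ 2)).mono' hmeas.aestronglyMeasurable
    (ae_of_all _ fun x => ?_)
  have hp := (pEmpD_pos (D := D) hn ht x).le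
  rw [Real.norm_of_nonneg (by positivity), ← mul_assoc]
  refine mul_le_mul_of_nonneg_right ?_ hp
  rw [EuclideanSpace.real_norm_sq_eq, Finset.sum_mul]
  refine Finset.sum_le_sum fun i _ => ?_
  have hx := norm_nonneg x
  have h1 : |(f x - scoreVec n D d t x) i| ≤ (|f 0 i| + K i + (D + 1) / t) * (1 + ‖x‖) := by
    have h2 := hK i x
    simp only [zero_add] at h2
    have h3 := abs_scoreVec_apply_le (d := d) hn hD ht x i
    have h4 : |(f x - scoreVec n D d t x) i| ≤ |f 0 i| + |f x i - f 0 i| +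
        |scoreVec n D d t x i| := by
      have e : (f x - scoreVec n D d t x) i = f 0 i + (f x i - f 0 i) - scoreVec n D d t x i := by
        simp
      rw [e]
      exact (abs_sub _ _).trans (add_le_add_left (abs_add_le _ _) _)
    have h5 : (D + ‖x‖) / t ≤ (D + 1) / t * (1 + ‖x‖) := by
      rw [div_mul_eq_mul_div]
      gcongr
      nlinarith
    have h6 := mul_nonneg (abs_nonneg (f 0 i)) hx
    have h7 := hK0 i
    linarith
  have h2 := pow_le_pow_left₀ (abs_nonneg _) h1 2
  rw [sq_abs, mul_pow] at h2
  have h3 : (1 + ‖x‖) ^ 2 ≤ 2 * (1 + ‖x‖ ^ 2) := by nlinarith [sq_nonneg (1 - ‖x‖)]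
  have h4 := mul_le_mul_of_nonneg_left h3 (sq_nonneg (|f 0 i| + K i + (D + 1) / t))
  linarith

end Integrability

section NearOptimality

variable {n d : ℕ} {D t ε : ℝ}

local notation "𝔼" => EuclideanSpace ℝ (Fin (d + 1))

/-- A map of small loss has large non-smoothness measure. -/
theorem ofReal_le_RnsD_of_loss_lt (hn : 2 ≤ n) (hD : 0 < D) (ht : 0 < t) {M : ℝ} (hM : 0 < M)
    (hv : 1 / 4 ≤ ∫ u in (0 : ℝ)..M, u ^ 2 * gaussD u 1)
    (hMt : √t * (2 * M) ≤ D / ((n : ℝ) - 1) / 2)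
    (he1 : √t * (2 * D * n / t * rexp (-(D / ((n : ℝ) - 1)) ^ 2 / t)) ≤ 1)
    (heε : 20 * (√t * (2 * D * n / t * rexp (-(D / ((n : ℝ) - 1)) ^ 2 / t))) ^ 2 < ε / 2)
    (hε : 0 < ε) {f : 𝔼 → 𝔼}
    (hf : ∀ (w b : 𝔼), ‖w‖ = 1 →
      Continuous (fun x : ℝ => f (x • w + b)) ∧
      {x : ℝ | ¬ DifferentiableAt ℝ (fun x : ℝ => f (x • w + b)) x}.Finite)
    (hR : RnsD d f ≠ ∞) (hloss : scoreLossD n D d t f < ε) :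
    ENNReal.ofReal (2 * ((n : ℝ) - 1) / t * (1 - 2 * √3 * √ε -
      2 * (√(n * ε / (M * gaussD (2 * M) 1)) + 2 * M + 1) * √t / (D / ((n : ℝ) - 1)))) ≤
      RnsD d f := by
  obtain ⟨c, hint, hc⟩ := exists_slice_loss_lt hn ht (continuous_of_RnsD hf hR)
    (integrable_loss_of_RnsD hn hD ht hf hR) hloss
  have hw : ‖(EuclideanSpace.single (0 : Fin (d + 1)) (1 : ℝ))‖ = 1 := by simp
  obtain ⟨hcont, hfin⟩ := hf _ (consPt 0 c) hw
  have hline : (fun x : ℝ => f (consPt x c) 0) = fun x : ℝ =>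
      f (x • EuclideanSpace.single (0 : Fin (d + 1)) (1 : ℝ) + consPt 0 c) 0 := by
    funext x
    rw [consPt_eq x c]
  have hcont0 : Continuous fun x : ℝ => f (consPt x c) 0 := by
    rw [hline]
    exact (EuclideanSpace.proj (𝕜 := ℝ) (0 : Fin (d + 1))).continuous.comp hcont
  have he0 : 0 ≤ √t * (2 * D * n / t * rexp (-(D / ((n : ℝ) - 1)) ^ 2 / t)) := by positivity
  obtain ⟨p, q, hp, hq, hpq, hqp, hle⟩ := exists_oscillation_of_loss_lt hn hD ht hM hv hMt he0 he1
    le_rfl hε heε hcont0 hfin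
    (fun x hx => by
      rw [hline]
      exact (deriv_euclidean_apply (not_not.1 hx) 0).differentiableAt) hint hc
  rw [hline] at hle
  exact (ENNReal.ofReal_le_ofReal hle).trans (ofReal_zigzag_le_RnsD f hw (consPt 0 c) 0 (n - 1) p q
    (fun k hk => not_not.1 (hp k hk)) (fun k hk => not_not.1 (hq k hk)) hpq hqp)

theorem tendsto_sqrt_nhdsGT_zero : Tendsto (fun t : ℝ => √t) (nhdsWithin 0 (Ioi 0)) (nhds 0) := by
  have := Real.continuous_sqrt.tendsto 0
  rw [Real.sqrt_zero] at this
  exact this.mono_left nhdsWithin_le_nhds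

theorem tendsto_sqrt_mul_exp (C : ℝ) {b : ℝ} (hb : 0 < b) :
    Tendsto (fun t : ℝ => √t * (C / t * rexp (-b ^ 2 / t))) (nhdsWithin 0 (Ioi 0)) (nhds 0) := by
  have h1 := (tendsto_rpow_mul_exp_neg_mul_atTop_nhds_zero 1 (b ^ 2) (by positivity)).comp
    tendsto_inv_nhdsGT_zero
  have h2 := tendsto_sqrt_nhdsGT_zero.mul (h1.const_mul C)
  rw [mul_zero, mul_zero] at h2
  refine h2.congr fun t => ?_
  simp only [Function.comp, Real.rpow_one]
  rw [div_eq_mul_inv C, div_eq_mul_inv (-b ^ 2), mul_assoc C]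

theorem one_lt_mul_of_small (hε : ε ∈ Ioo (0 : ℝ) 0.015) :
    1 < (1 + 8 * √ε) * (1 - 2 * √3 * √ε) := by
  have h0 : 0 < √ε := Real.sqrt_pos.2 hε.1
  have h1 : √ε < 0.1225 := by
    rw [Real.sqrt_lt' (by norm_num)]
    have := hε.2
    norm_num at this ⊢
    linarith
  have h3 : √3 < 1.7321 := by
    rw [Real.sqrt_lt' (by norm_num)]
    norm_num
  have h30 : 0 ≤ √3 := Real.sqrt_nonneg 3
  have h4 : 16 * (√3 * √ε) + 2 * √3 < 8 := by
    have : √3 * √ε ≤ 1.7321 * 0.1225 := mul_le_mul h3.le h1.le h0.le (by norm_num)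
    norm_num at this h3
    linarith
  have h5 := mul_lt_mul_of_pos_left h4 h0
  linarith

end NearOptimality

/-- near-optimality of the multi-dimensional smoothed PL-ESF
`ŝ⃗_{t,δ_t}(x) = (ŝ_{t,δ_t}(x₁), -x₂/t, …, -x_d/t)` for the `(d+1)`-dimensional
variational problem. -/
theorem stmt_14 (n : ℕ) (hn : 2 ≤ n) (D : ℝ) (hD : 0 < D)
    (ε : ℝ) (hε : ε ∈ Set.Ioo (0 : ℝ) 0.015)
    (κ : ℝ) (hκ : 0 < κ) (hFκ : Fgauss κ ≤ ε) (d : ℕ) :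
    ∃ t₁ > (0 : ℝ), ∀ t ∈ Set.Ioo 0 t₁,
      (κ * Real.sqrt t ∈ Set.Ioo 0 (D / ((n : ℝ) - 1)) ∧
        ∀ (s : ℝ → ℝ)
          (svec : EuclideanSpace ℝ (Fin (d + 1)) → EuclideanSpace ℝ (Fin (d + 1))),
          IsShat n D t (κ * Real.sqrt t) s →
          (∀ x i, svec x i = if i = 0 then s (x 0) else -(x i) / t) →
          scoreLossD n D d t svec < ε ∧
          RnsD d svec = ENNReal.ofReal (2 * ((n : ℝ) - 1) * (D / ((n : ℝ) - 1)) /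
            (t * (D / ((n : ℝ) - 1) - κ * Real.sqrt t)))) ∧
      ∀ f : EuclideanSpace ℝ (Fin (d + 1)) → EuclideanSpace ℝ (Fin (d + 1)),
        (∀ (w b : EuclideanSpace ℝ (Fin (d + 1))), ‖w‖ = 1 →
          Continuous (fun x : ℝ => f (x • w + b)) ∧
          {x : ℝ | ¬ DifferentiableAt ℝ (fun x : ℝ => f (x • w + b)) x}.Finite) →
        scoreLossD n D d t f < ε →
        ENNReal.ofReal (2 * ((n : ℝ) - 1) * (D / ((n : ℝ) - 1)) /
            (t * (D / ((n : ℝ) - 1) - κ * Real.sqrt t))) <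
          ENNReal.ofReal (1 + 8 * Real.sqrt ε) * RnsD d f := by
  have hn3 : (2 : ℝ) ≤ n := by exact_mod_cast hn
  have hΔ0 : 0 < D / ((n : ℝ) - 1) := div_pos hD (by linarith)
  obtain ⟨M, hM, hv⟩ := exists_quarter_le_integral_sq_mul_gaussD
  have hs := tendsto_sqrt_nhdsGT_zero
  have hexp := tendsto_sqrt_mul_exp (2 * D * n) hΔ0
  have hκt := hs.const_mul κ
  rw [mul_zero] at hκt
  have hratio : Tendsto (fun t : ℝ => D / ((n : ℝ) - 1) / (D / ((n : ℝ) - 1) - κ * √t))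
      (nhdsWithin 0 (Ioi 0)) (nhds 1) := by
    have := (tendsto_const_nhds (x := D / ((n : ℝ) - 1))).div
      ((tendsto_const_nhds (x := D / ((n : ℝ) - 1))).sub hκt) (by rw [sub_zero]; exact hΔ0.ne')
    rwa [sub_zero, div_self hΔ0.ne'] at this
  have ea := hκt.eventually_lt_const hΔ0
  have eb : ∀ᶠ t : ℝ in nhdsWithin 0 (Ioi 0),
      ((n : ℝ) - 1) / n * (D / ((n : ℝ) - 1) / (D / ((n : ℝ) - 1) - κ * √t)) ^ 2 < 1 := by
    refine ((hratio.pow 2).const_mul (((n : ℝ) - 1) / n)).eventually_lt_const ?_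
    rw [one_pow, mul_one, div_lt_one (by linarith)]
    linarith
  have ec : ∀ᶠ t : ℝ in nhdsWithin 0 (Ioi 0), √t * (2 * M) < D / ((n : ℝ) - 1) / 2 :=
    (hs.mul_const (2 * M)).eventually_lt_const (by rw [zero_mul]; exact half_pos hΔ0)
  have ed := hexp.eventually_lt_const one_pos
  have ee := ((hexp.pow 2).const_mul 20).eventually_lt_const (u := ε / 2) (by
    rw [zero_pow two_ne_zero, mul_zero]; exact half_pos hε.1)
  have ef : ∀ᶠ t : ℝ in nhdsWithin 0 (Ioi 0),
      D / ((n : ℝ) - 1) / (D / ((n : ℝ) - 1) - κ * √t) < (1 + 8 * √ε) * (1 - 2 * √3 * √ε -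
      2 * (√(n * ε / (M * gaussD (2 * M) 1)) + 2 * M + 1) * √t / (D / ((n : ℝ) - 1))) := by
    have h1 := ((tendsto_const_nhds (x := 1 - 2 * √3 * √ε)).sub
      ((hs.const_mul (2 * (√(n * ε / (M * gaussD (2 * M) 1)) + 2 * M + 1))).div_const
        (D / ((n : ℝ) - 1)))).const_mul (1 + 8 * √ε)
    rw [mul_zero, zero_div, sub_zero] at h1
    exact hratio.eventually_lt h1 (one_lt_mul_of_small hε)
  obtain ⟨t₁, ht₁, hsub⟩ := mem_nhdsGT_iff_exists_Ioo_subset.1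
    (ea.and (eb.and (ec.and (ed.and (ee.and ef)))))
  refine ⟨t₁, ht₁, fun t htt => ?_⟩
  obtain ⟨ha, hb, hc, hd, he, hlast⟩ := hsub htt
  have ht : 0 < t := htt.1
  have hδ : κ * √t ∈ Ioo 0 (D / ((n : ℝ) - 1)) := ⟨mul_pos hκ (Real.sqrt_pos.2 ht), ha⟩
  refine ⟨⟨hδ, fun s svec hs hsv => ⟨?_, hs.RnsD_eq hn hD ht hδ hsv⟩⟩, fun f hf hloss => ?_⟩
  · rw [scoreLossD_of_first_coord hn ht hsv]
    refine (hs.loss_le hn hD ht hκ hδ).trans_lt ?_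
    have h1n : 0 ≤ ((n : ℝ) - 1) / n := div_nonneg (by linarith) (by linarith)
    refine (mul_le_mul_of_nonneg_left hFκ (mul_nonneg h1n (sq_nonneg _))).trans_lt ?_
    exact mul_lt_of_lt_one_left hε.1 hb
  · have hpos : 0 < 1 + 8 * √ε := by positivity
    by_cases hR : RnsD d f = ∞
    · rw [hR, ENNReal.mul_top (ENNReal.ofReal_pos.2 hpos).ne']
      exact ENNReal.ofReal_lt_top
    · refine lt_of_lt_of_le ?_ (mul_le_mul_right (ofReal_le_RnsD_of_loss_lt hn hD ht hM hv hc.le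
        hd.le he hε.1 hf hR hloss) _)
      rw [← ENNReal.ofReal_mul hpos.le]
      have hk : 0 < 2 * ((n : ℝ) - 1) / t := div_pos (by linarith) ht
      have h1 := mul_lt_mul_of_pos_left hlast hk
      have h2 : 2 * ((n : ℝ) - 1) / t * (D / ((n : ℝ) - 1) / (D / ((n : ℝ) - 1) - κ * √t)) =
          2 * ((n : ℝ) - 1) * (D / ((n : ℝ) - 1)) / (t * (D / ((n : ℝ) - 1) - κ * √t)) :=
        div_mul_div_comm _ _ _ _
      rw [h2] at h1
      have h3 : 0 < 2 * ((n : ℝ) - 1) * (D / ((n : ℝ) - 1)) /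
          (t * (D / ((n : ℝ) - 1) - κ * √t)) :=
        div_pos (mul_pos (by linarith) hΔ0) (mul_pos ht (sub_pos.2 ha))
      have h4 := h1.trans_eq (mul_left_comm _ _ _)
      exact (ENNReal.ofReal_lt_ofReal_iff (h3.trans h4)).2 h4
end

section
/- Let κ > 0, t ∈ (0, 1/κ²), d ≥ 1, and x = (x₁, …, x_d) ∈ ℝ^d. Define Φ_{u|t}(x) = (φ_{u|t}(x₁), √(u/t) x₂, …, √(u/t) x_d) for u ∈ (0, t]. Then the curve u ↦ Φ_{u|t}(x) satisfies Φ_{t|t}(x) = x and, for all u ∈ (0, t]: d/du [Φ_{u|t}(x)]₁ = −(1/2) · ŝ_{u,δ_u}([Φ_{u|t}(x)]₁), and d/du [Φ_{u|t}(x)]_i = [Φ_{u|t}(x)]_i / (2u) for each i ∈ {2, …, d}. -/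
open MeasureTheory Real Set Filter
open scoped ENNReal

/-- The smoothed piecewise-linear empirical score function `ŝ_{t,δ}` for the
training set `{-1, +1}`. -/
noncomputable def shat2 (t δ x : ℝ) : ℝ :=
  if x ≤ δ - 1 then -(x + 1) / t
  else if 1 - δ ≤ x then -(x - 1) / t
  else (δ / (1 - δ)) * x / t

/-- The flow map `φ_{s|t}` of the denoising dynamics under `ŝ` with `δ_u = κ√u`,
for the training set `{-1, +1}`. -/
noncomputable def phiFlow (κ s t x : ℝ) : ℝ :=
  if x ≤ κ * Real.sqrt t - 1 then
    Real.sqrt (s / t) * x - (1 - Real.sqrt (s / t))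
  else if 1 - κ * Real.sqrt t ≤ x then
    Real.sqrt (s / t) * x + (1 - Real.sqrt (s / t))
  else ((1 - κ * Real.sqrt s) / (1 - κ * Real.sqrt t)) * x

theorem mul_sqrt_lt_one {κ t u : ℝ} (hκ : 0 < κ) (ht : t < 1 / κ ^ 2) (hut : u ≤ t) :
    κ * √u < 1 := by
  have h : √u < 1 / κ := by
    rw [Real.sqrt_lt' (by positivity), div_pow, one_pow]
    exact hut.trans_lt ht
  rwa [lt_div_iff₀ hκ, mul_comm] at h

theorem hasDerivAt_sqrt_div {t u : ℝ} (hu : 0 < u) (ht : 0 < t) :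
    HasDerivAt (fun v => √(v / t)) (√(u / t) / (2 * u)) u := by
  have h := ((hasDerivAt_id u).div_const t).sqrt (div_pos hu ht).ne'
  refine h.congr_deriv ?_
  have hs : 0 < √(u / t) := Real.sqrt_pos.2 (div_pos hu ht)
  have hsq : √(u / t) ^ 2 = u / t := Real.sq_sqrt (div_pos hu ht).le
  simp only [id]
  rw [div_eq_div_iff (by positivity) (by positivity),
    show √(u / t) * (2 * √(u / t)) = 2 * √(u / t) ^ 2 by ring, hsq]
  ring

theorem phiFlow_self {κ t : ℝ} (ht : 0 < t) (h : κ * √t < 1) (x : ℝ) :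
    phiFlow κ t t x = x := by
  have h1 : 1 - κ * √t ≠ 0 := by linarith
  simp [phiFlow, div_self ht.ne', div_self h1]

/-- The flow map solves the denoising equation driven by the smoothed score. -/
theorem hasDerivAt_phiFlow {κ t u : ℝ} (hu : 0 < u) (hut : u ≤ t) (hδu : κ * √u < 1)
    (hδt : κ * √t < 1) (x : ℝ) :
    HasDerivAt (fun v => phiFlow κ v t x) (-(1 / 2) * shat2 u (κ * √u) (phiFlow κ u t x)) u := by
  have ht : 0 < t := hu.trans_le hut
  have hst : 0 < √t := Real.sqrt_pos.2 ht
  have hr : HasDerivAt (fun v => √(v / t)) (√(u / t) / (2 * u)) u := hasDerivAt_sqrt_div hu ht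
  have hrpos : 0 ≤ √(u / t) := Real.sqrt_nonneg _
  have hrt : √(u / t) * (κ * √t) = κ * √u := by
    rw [Real.sqrt_div hu.le]
    field_simp
  unfold phiFlow
  split_ifs with hl hr'
  · have hmem : √(u / t) * x - (1 - √(u / t)) ≤ κ * √u - 1 := by
      nlinarith [mul_le_mul_of_nonneg_left hl hrpos]
    rw [shat2, if_pos hmem]
    refine ((hr.mul_const x).sub (hr.const_sub 1)).congr_deriv ?_
    field_simp
    ring
  · have hmem : 1 - κ * √u ≤ √(u / t) * x + (1 - √(u / t)) := by
      nlinarith [mul_le_mul_of_nonneg_left hr' hrpos]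
    rw [shat2, if_neg (by linarith), if_pos hmem]
    refine ((hr.mul_const x).add (hr.const_sub 1)).congr_deriv ?_
    field_simp
    ring
  · push Not at hl hr'
    have hu1 : 0 < 1 - κ * √u := by linarith
    have ht1 : 0 < 1 - κ * √t := by linarith
    have hq : 0 < (1 - κ * √u) / (1 - κ * √t) := div_pos hu1 ht1
    have hqt : (1 - κ * √u) / (1 - κ * √t) * (1 - κ * √t) = 1 - κ * √u :=
      div_mul_cancel₀ _ ht1.ne'
    have hlo : κ * √u - 1 < (1 - κ * √u) / (1 - κ * √t) * x := by
      linarith [mul_lt_mul_of_pos_left hl hq]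
    have hhi : (1 - κ * √u) / (1 - κ * √t) * x < 1 - κ * √u := by
      linarith [mul_lt_mul_of_pos_left hr' hq]
    rw [shat2, if_neg hlo.not_ge, if_neg hhi.not_ge]
    refine (((((Real.hasDerivAt_sqrt hu.ne').const_mul κ).const_sub 1).div_const
      (1 - κ * √t)).mul_const x).congr_deriv ?_
    have hsq : √u ^ 2 = u := Real.sq_sqrt hu.le
    field_simp
    rw [hsq]
    ring

/-- in dimension `d + 1 ≥ 1`, the curve
`u ↦ Φ_{u|t}(x) = (φ_{u|t}(x₁), √(u/t) x₂, …, √(u/t) x_d)` has terminal value `x` at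
`u = t`, its first coordinate solves `d/du = -(1/2) ŝ_{u,δ_u}(·)`, and every other
coordinate `i` solves `d/du = [Φ_{u|t}(x)]_i / (2u)` on `(0, t]`. -/
theorem stmt_17 (κ : ℝ) (hκ : 0 < κ) (t : ℝ) (ht : t ∈ Set.Ioo 0 (1 / κ ^ 2))
    (d : ℕ) (x : EuclideanSpace ℝ (Fin (d + 1)))
    (Φ : ℝ → EuclideanSpace ℝ (Fin (d + 1)))
    (hΦ : ∀ u (i : Fin (d + 1)),
      Φ u i = if i = 0 then phiFlow κ u t (x 0) else Real.sqrt (u / t) * x i) :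
    Φ t = x ∧
    (∀ u ∈ Set.Ioc 0 t,
      HasDerivWithinAt (fun v => Φ v 0)
        (-(1 / 2) * shat2 u (κ * Real.sqrt u) (Φ u 0)) (Set.Ioc 0 t) u) ∧
    ∀ u ∈ Set.Ioc 0 t, ∀ i : Fin (d + 1), i ≠ 0 →
      HasDerivWithinAt (fun v => Φ v i) (Φ u i / (2 * u)) (Set.Ioc 0 t) u := by
  obtain ⟨ht0, htκ⟩ := ht
  have hδt : κ * √t < 1 := mul_sqrt_lt_one hκ htκ le_rfl
  refine ⟨?_, fun u hu => ?_, fun u hu i hi => ?_⟩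
  · ext i
    rw [hΦ]
    split_ifs with hi
    · rw [phiFlow_self ht0 hδt, hi]
    · rw [div_self ht0.ne', Real.sqrt_one, one_mul]
  · simp only [hΦ, if_true]
    exact (hasDerivAt_phiFlow hu.1 hu.2 (mul_sqrt_lt_one hκ htκ hu.2) hδt
      (x 0)).hasDerivWithinAt
  · simp only [hΦ, if_neg hi]
    exact (((hasDerivAt_sqrt_div hu.1 ht0).mul_const (x i)).congr_deriv
      (div_mul_eq_mul_div _ _ _)).hasDerivWithinAt
end
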